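/- Let R ∈ (0,∞], let a be a locally finite nonnegative Borel measure on [0,R), and let b : [0,R) → ℝ be locally square-integrable. For each ξ > 0 let φ_ξ be the unique solution of the boundary-value problem (★) for the data (R, a, b, ξ). Then for each ξ > 0 the right limit φ_ξ′(0⁺) exists, and the function ψ(ξ) = −(1/2)φ_ξ′(0⁺) + (1/2) a({0}) ξ², defined for ξ > 0, extends to a Rogers function. -/

import Mathlib

open MeasureTheory Filter Set
open scoped ENNReal Topology

noncomputable section

/-- A *Rogers function*: holomorphic on the right half-plane, with `Re (F z / z) ≥ 0` there. -/
def IsRogersFunction (F : ℂ → ℂ) : Prop :=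
  DifferentiableOn ℂ F {z : ℂ | 0 < z.re} ∧ ∀ z : ℂ, 0 < z.re → 0 ≤ (F z / z).re

/-- `Ψ` extends to a Rogers function: some Rogers function agrees with `Ψ` on `(0, ∞)`. -/
def ExtendsToRogersFunction (Ψ : ℝ → ℂ) : Prop :=
  ∃ F : ℂ → ℂ, IsRogersFunction F ∧ ∀ ξ : ℝ, 0 < ξ → F (ξ : ℂ) = Ψ ξ

/-- The interval `[0, R)` as a subset of `ℝ`, where `R ∈ (0, ∞]`. -/
def IsetOf (R : ℝ≥0∞) : Set ℝ := {y : ℝ | 0 ≤ y ∧ ENNReal.ofReal y < R}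

/-- `a` is a locally finite nonnegative Borel measure on `[0, R)`:
it is carried by `[0, R)` and finite on compact subsets of `[0, R)`. -/
def LocallyFiniteOnHalf (R : ℝ≥0∞) (a : MeasureTheory.Measure ℝ) : Prop :=
  a ((IsetOf R)ᶜ) = 0 ∧ ∀ y ∈ IsetOf R, a (Set.Icc 0 y) < ⊤

/-- `b` is locally square-integrable on `[0, R)`. -/
def LocL2OnHalf (R : ℝ≥0∞) (b : ℝ → ℝ) : Prop :=
  ∀ y ∈ IsetOf R, MeasureTheory.IntegrableOn (fun t => (b t) ^ 2) (Set.Icc 0 y)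

/-- A solution `φ` (with right-continuous locally-BV version `v` of `φ′`) of the
boundary-value problem (★) for data `(R, a, b, ξ)`:
`φ` is locally absolutely continuous on `[0, R)` with a.e. derivative `v`; `φ(0) = 1`;
`φ` is bounded on `[0, R)`; `φ(y) → 0` as `y → R⁻` when `R < ∞`; and the distributional
second derivative of `φ` is the locally finite measure determined by
`(1/2) φ″(dy) = (1/2) ξ² φ(y) a(dy) + (1/2) ξ² φ(y) b(y)² dy − i ξ φ′(y) b(y) dy` on `(0, R)`,
expressed here through the increments of `v`. -/
structure IsStarSolution (R : ℝ≥0∞) (a : MeasureTheory.Measure ℝ) (b : ℝ → ℝ) (ξ : ℝ)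
    (φ : ℝ → ℂ) (v : ℝ → ℂ) : Prop where
  init : φ 0 = 1
  deriv_integrable : ∀ y ∈ IsetOf R, MeasureTheory.IntegrableOn v (Set.Icc 0 y)
  locAC : ∀ y ∈ IsetOf R, φ y = 1 + ∫ t in (0:ℝ)..y, v t
  right_cont : ∀ y ∈ IsetOf R, 0 < y → ContinuousWithinAt v (Set.Ici y) y
  bounded : ∃ M : ℝ, ∀ y ∈ IsetOf R, ‖φ y‖ ≤ M
  boundary : R ≠ ⊤ →
    Filter.Tendsto φ (nhdsWithin R.toReal (Set.Iio R.toReal)) (nhds 0)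
  integ_a : ∀ y ∈ IsetOf R, MeasureTheory.IntegrableOn φ (Set.Icc 0 y) a
  integ_vb : ∀ y ∈ IsetOf R,
    MeasureTheory.IntegrableOn (fun t => v t * (b t : ℂ)) (Set.Icc 0 y)
  integ_φb : ∀ y ∈ IsetOf R,
    MeasureTheory.IntegrableOn (fun t => φ t * (b t : ℂ) ^ 2) (Set.Icc 0 y)
  eqn : ∀ y₁ y₂ : ℝ, 0 < y₁ → y₁ ≤ y₂ → y₂ ∈ IsetOf R →
    v y₂ - v y₁ = (ξ : ℂ) ^ 2 * ∫ y in Set.Ioc y₁ y₂, φ y ∂a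
      + ∫ t in y₁..y₂,
          ((ξ : ℂ) ^ 2 * φ t * (b t : ℂ) ^ 2 - 2 * Complex.I * (ξ : ℂ) * v t * (b t : ℂ))

theorem isPreconnected_rightHalfPlane : IsPreconnected {z : ℂ | 0 < z.re} :=
  (convex_halfSpace_re_gt 0).isPreconnected

theorem isOpen_rightHalfPlane : IsOpen {z : ℂ | 0 < z.re} :=
  isOpen_lt continuous_const Complex.continuous_re

/-- A pointwise limit along an arbitrary filter of uniformly bounded holomorphic functions on an
open set is holomorphic. -/
theorem differentiableOn_of_tendsto_of_norm_le {ι : Type*} {l : Filter ι} [l.NeBot] {U : Set ℂ}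
    (hU : IsOpen U) {f : ι → ℂ → ℂ} {g : ℂ → ℂ} {C : ℝ}
    (hf : ∀ i, DifferentiableOn ℂ (f i) U) (hC : ∀ i, ∀ z ∈ U, ‖f i z‖ ≤ C)
    (hg : ∀ z ∈ U, Tendsto (fun i => f i z) l (𝓝 (g z))) : DifferentiableOn ℂ g U := by
  intro x hx
  obtain ⟨r, hr, hrU⟩ := Metric.isOpen_iff.1 hU x hx
  have hC0 : 0 ≤ C := by
    obtain ⟨i⟩ := l.nonempty_of_neBot
    exact (norm_nonneg _).trans (hC i x hx)
  set s := r / 3 with hs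
  have hs0 : 0 < s := by positivity
  have hlip : ∀ i, ∀ y ∈ Metric.ball x s, ∀ w ∈ Metric.ball x s,
      ‖f i y - f i w‖ ≤ C / s * ‖y - w‖ := by
    intro i y hy w hw
    refine (convex_ball x s).norm_image_sub_le_of_norm_deriv_le (𝕜 := ℂ) (f := f i)
      (fun u hu => ?_) (fun u hu => ?_) hw hy
    · refine (hf i).differentiableAt (hU.mem_nhds (hrU ?_))
      exact Metric.ball_subset_ball (by linarith) hu
    · have hsub : Metric.closedBall u s ⊆ U := fun t ht => hrU (by
        rw [Metric.mem_ball] at hu ⊢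
        rw [Metric.mem_closedBall] at ht
        linarith [dist_triangle t u x])
      refine Complex.norm_deriv_le_of_forall_mem_sphere_norm_le hs0
        (DifferentiableOn.diffContOnCl ?_) (fun t ht => hC i t (hsub (Metric.sphere_subset_closedBall ht)))
      rw [closure_ball u hs0.ne']
      exact (hf i).mono hsub
  have hlipg : ∀ y ∈ Metric.ball x s, ∀ w ∈ Metric.ball x s,
      ‖g y - g w‖ ≤ C / s * ‖y - w‖ := by
    intro y hy w hw
    have hyU : y ∈ U := hrU (Metric.ball_subset_ball (by linarith) hy)
    have hwU : w ∈ U := hrU (Metric.ball_subset_ball (by linarith) hw)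
    exact le_of_tendsto ((hg y hyU).sub (hg w hwU)).norm
      (Eventually.of_forall fun i => hlip i y hy w hw)
  have hloc : TendstoLocallyUniformlyOn f g l (Metric.ball x s) := by
    rw [Metric.tendstoLocallyUniformlyOn_iff]
    intro ε hε w hw
    set δ := ε / (3 * (C / s + 1)) with hδ
    have hK : 0 < C / s + 1 := by positivity
    have hδ0 : 0 < δ := by positivity
    have hwU : w ∈ U := hrU (Metric.ball_subset_ball (by linarith) hw)
    refine ⟨Metric.ball x s ∩ Metric.ball w δ,
      inter_mem self_mem_nhdsWithin (mem_nhdsWithin_of_mem_nhds (Metric.ball_mem_nhds w hδ0)), ?_⟩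
    filter_upwards [Metric.tendsto_nhds.1 (hg w hwU) (ε / 3) (by positivity)] with i hi y hy
    have h1 := hlip i y hy.1 w hw
    have h2 := hlipg y hy.1 w hw
    have h3 : C / s * ‖y - w‖ ≤ ε / 3 := by
      have hyw : ‖y - w‖ ≤ δ := by rw [← dist_eq_norm]; exact (Metric.mem_ball.1 hy.2).le
      calc C / s * ‖y - w‖ ≤ (C / s + 1) * δ := by gcongr; linarith
        _ = ε / 3 := by rw [hδ]; field_simp
    rw [dist_eq_norm] at hi ⊢
    have h4 : g y - f i y = (g y - g w) - (f i w - g w) - (f i y - f i w) := by ring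
    rw [h4]
    have h5 := norm_sub_le ((g y - g w) - (f i w - g w)) (f i y - f i w)
    have h6 := norm_sub_le (g y - g w) (f i w - g w)
    linarith
  exact (hloc.differentiableOn (Eventually.of_forall fun i => (hf i).mono
    fun u hu => hrU (Metric.ball_subset_ball (by linarith) hu)) Metric.isOpen_ball).differentiableAt
    (Metric.isOpen_ball.mem_nhds (Metric.mem_ball_self hs0)) |>.differentiableWithinAt

/-- Holomorphic functions on the right half-plane with nonnegative real part that converge
pointwise on `(0, ∞)` have a limit function of the same kind. -/
theorem exists_limit_of_re_nonneg {G : ℕ → ℂ → ℂ} {γ : ℝ → ℂ}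
    (hG : ∀ n, DifferentiableOn ℂ (G n) {z : ℂ | 0 < z.re})
    (hre : ∀ n, ∀ z : ℂ, 0 < z.re → 0 ≤ (G n z).re)
    (hlim : ∀ ξ : ℝ, 0 < ξ → Tendsto (fun n => G n ξ) atTop (𝓝 (γ ξ))) :
    ∃ F : ℂ → ℂ, DifferentiableOn ℂ F {z : ℂ | 0 < z.re} ∧
      (∀ z : ℂ, 0 < z.re → 0 ≤ (F z).re) ∧ ∀ ξ : ℝ, 0 < ξ → F ξ = γ ξ := by
  set U := {z : ℂ | 0 < z.re} with hU
  have hne : ∀ n, ∀ z ∈ U, G n z + 1 ≠ 0 := by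
    intro n z hz h
    have h1 := congrArg Complex.re h
    have h2 := hre n z hz
    simp at h1
    linarith
  set E : ℕ → ℂ → ℂ := fun n z => (G n z + 1)⁻¹ with hE
  have hEd : ∀ n, DifferentiableOn ℂ (E n) U := fun n =>
    ((hG n).add_const 1).inv (hne n)
  have hEb : ∀ n, ∀ z ∈ U, ‖E n z‖ ≤ 1 := by
    intro n z hz
    have h1 : 1 ≤ ‖G n z + 1‖ := by
      refine le_trans ?_ (Complex.re_le_norm _)
      have := hre n z hz
      simp only [Complex.add_re, Complex.one_re]
      linarith
    simp only [hE, norm_inv]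
    exact inv_le_one_of_one_le₀ h1
  have hEre : ∀ n, ∀ z ∈ U, ‖E n z‖ ^ 2 ≤ (E n z).re := by
    intro n z hz
    have h0 : 0 < Complex.normSq (G n z + 1) := Complex.normSq_pos.2 (hne n z hz)
    have := hre n z hz
    rw [← Complex.normSq_eq_norm_sq]
    simp only [hE, Complex.inv_re, Complex.normSq_inv, Complex.add_re, Complex.one_re]
    rw [inv_eq_one_div]
    gcongr
    linarith
  obtain ⟨u, hu⟩ : ∃ u : Ultrafilter ℕ, (u : Filter ℕ) ≤ atTop :=
    ⟨Ultrafilter.of atTop, Ultrafilter.of_le atTop⟩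
  have hex : ∀ z ∈ U, ∃ w, Tendsto (fun n => E n z) u (𝓝 w) := by
    intro z hz
    obtain ⟨w, -, hw⟩ := (isCompact_closedBall (0 : ℂ) 1).ultrafilter_le_nhds
      (u.map fun n => E n z) (by
        rw [le_principal_iff]
        exact Filter.mem_map.2 (Filter.univ_mem' fun n => by simpa using hEb n z hz))
    exact ⟨w, hw⟩
  choose! e he using hex
  have hed : DifferentiableOn ℂ e U :=
    differentiableOn_of_tendsto_of_norm_le isOpen_rightHalfPlane hEd hEb he
  have here : ∀ z ∈ U, ‖e z‖ ^ 2 ≤ (e z).re := fun z hz =>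
    le_of_tendsto_of_tendsto' ((he z hz).norm.pow 2)
      ((Complex.continuous_re.tendsto _).comp (he z hz)) fun n => hEre n z hz
  have hγne : ∀ ξ : ℝ, 0 < ξ → γ ξ + 1 ≠ 0 := by
    intro ξ hξ h
    have h1 : 0 ≤ (γ ξ).re := ge_of_tendsto' ((Complex.continuous_re.tendsto _).comp (hlim ξ hξ))
      fun n => hre n ξ (by simpa using hξ)
    have h2 := congrArg Complex.re h
    simp at h2
    linarith
  have heγ : ∀ ξ : ℝ, 0 < ξ → e ξ = (γ ξ + 1)⁻¹ := fun ξ hξ =>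
    tendsto_nhds_unique (he ξ (by simpa [hU] using hξ))
      ((((hlim ξ hξ).add_const 1).inv₀ (hγne ξ hξ)).mono_left hu)
  have hene : ∀ z ∈ U, e z ≠ 0 := by
    intro z hz h0
    have h1U : (1 : ℂ) ∈ U := by simp [hU]
    have hmax : IsMaxOn (norm ∘ fun w => Complex.exp (-e w)) U z := by
      intro w hw
      have := here w hw
      have h3 : 0 ≤ (e w).re := (sq_nonneg _).trans this
      simp [Complex.norm_exp, h0, h3]
    have h2 := Complex.norm_eqOn_of_isPreconnected_of_isMaxOn isPreconnected_rightHalfPlane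
      isOpen_rightHalfPlane (hed.neg.cexp) hz hmax h1U
    simp [Complex.norm_exp, h0] at h2
    have h3 := here 1 h1U
    rw [h2] at h3
    have h4 : e 1 = 0 := by
      have : ‖e 1‖ = 0 := by nlinarith [norm_nonneg (e 1)]
      simpa using this
    have h5 := heγ 1 one_pos
    simp only [Complex.ofReal_one] at h5
    rw [h4] at h5
    exact inv_ne_zero (hγne 1 one_pos) h5.symm
  refine ⟨fun z => (e z)⁻¹ - 1, (hed.inv hene).sub_const 1, fun z hz => ?_, fun ξ hξ => ?_⟩
  · have h1 := here z hz
    have h0 : 0 < Complex.normSq (e z) := Complex.normSq_pos.2 (hene z hz)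
    rw [← Complex.normSq_eq_norm_sq] at h1
    simp only [Complex.sub_re, Complex.inv_re, Complex.one_re, sub_nonneg]
    rwa [one_le_div h0]
  · simp only [heγ ξ hξ, inv_inv, add_sub_cancel_right]

/-- **Fubini for products of primitives**: the product of an integral against `μ` and an integral
against Lebesgue measure, split along the diagonal. -/
theorem setIntegral_mul_setIntegral {μ : Measure ℝ} {Y : ℝ} (hμ : μ (Ioc 0 Y) < ⊤) {f e : ℝ → ℂ}
    (hf : IntegrableOn f (Ioc 0 Y) μ) (he : IntegrableOn e (Ioc 0 Y)) :
    IntegrableOn (fun s => f s * ∫ t in Ioc 0 s, e t) (Ioc 0 Y) μ ∧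
    IntegrableOn (fun t => e t * ∫ s in Ioc 0 t, f s ∂μ) (Ioc 0 Y) ∧
    (∫ s in Ioc 0 Y, f s ∂μ) * (∫ t in Ioc 0 Y, e t) =
      (∫ s in Ioc 0 Y, (f s * ∫ t in Ioc 0 s, e t) ∂μ) +
        ∫ t in Ioc 0 Y, (e t * ∫ s in Ioc 0 t, f s ∂μ) := by
  have : IsFiniteMeasure (μ.restrict (Ioc 0 Y)) := ⟨by simpa using hμ⟩
  set μ' := μ.restrict (Ioc 0 Y)
  set ν' := (volume : Measure ℝ).restrict (Ioc 0 Y)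
  have hint : Integrable (fun x : ℝ × ℝ => f x.1 * e x.2) (μ'.prod ν') := hf.mul_prod he
  have hA : MeasurableSet {x : ℝ × ℝ | x.2 < x.1} := measurableSet_lt measurable_snd measurable_fst
  have hA1 := hint.indicator hA
  have hA2 := hint.indicator hA.compl
  have e1 : ∀ s ∈ Ioc 0 Y, (∫ t, {x : ℝ × ℝ | x.2 < x.1}.indicator
      (fun x : ℝ × ℝ => f x.1 * e x.2) (s, t) ∂ν') = f s * ∫ t in Ioc 0 s, e t := by
    intro s hs
    have : (fun t => {x : ℝ × ℝ | x.2 < x.1}.indicator (fun x : ℝ × ℝ => f x.1 * e x.2) (s, t))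
        = fun t => f s * (Iio s).indicator e t := by
      ext t
      by_cases h : t < s <;> simp [h]
    rw [this, integral_const_mul, integral_indicator measurableSet_Iio,
      Measure.restrict_restrict measurableSet_Iio, integral_Ioc_eq_integral_Ioo]
    congr 3
    ext t
    simp only [mem_inter_iff, mem_Iio, mem_Ioc, mem_Ioo]
    exact ⟨fun h => ⟨h.2.1, h.1⟩, fun h => ⟨h.2, h.1, h.2.le.trans hs.2⟩⟩
  have e2 : ∀ t ∈ Ioc 0 Y, (∫ s, {x : ℝ × ℝ | x.2 < x.1}ᶜ.indicator
      (fun x : ℝ × ℝ => f x.1 * e x.2) (s, t) ∂μ') = e t * ∫ s in Ioc 0 t, f s ∂μ := by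
    intro t ht
    have : (fun s => {x : ℝ × ℝ | x.2 < x.1}ᶜ.indicator (fun x : ℝ × ℝ => f x.1 * e x.2) (s, t))
        = fun s => e t * (Iic t).indicator f s := by
      ext s
      by_cases h : t < s
      · simp [h]
      · simp [h, not_lt.1 h, mul_comm]
    rw [this, integral_const_mul, integral_indicator measurableSet_Iic,
      Measure.restrict_restrict measurableSet_Iic]
    congr 3
    ext s
    simp only [mem_inter_iff, mem_Iic, mem_Ioc]
    exact ⟨fun h => ⟨h.2.1, h.1⟩, fun h => ⟨h.2, h.1, h.2.trans ht.2⟩⟩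
  have i1 := hA1.integral_prod_left
  have i2 := hA2.integral_prod_right
  have c1 : (fun s => ∫ t, {x : ℝ × ℝ | x.2 < x.1}.indicator
      (fun x : ℝ × ℝ => f x.1 * e x.2) (s, t) ∂ν') =ᵐ[μ'] fun s => f s * ∫ t in Ioc 0 s, e t :=
    (ae_restrict_iff' measurableSet_Ioc).2 (Eventually.of_forall e1)
  have c2 : (fun t => ∫ s, {x : ℝ × ℝ | x.2 < x.1}ᶜ.indicator
      (fun x : ℝ × ℝ => f x.1 * e x.2) (s, t) ∂μ') =ᵐ[ν'] fun t => e t * ∫ s in Ioc 0 t, f s ∂μ :=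
    (ae_restrict_iff' measurableSet_Ioc).2 (Eventually.of_forall e2)
  refine ⟨i1.congr c1, i2.congr c2, ?_⟩
  rw [← integral_congr_ae c1, ← integral_congr_ae c2, ← integral_prod _ hA1,
    ← integral_prod_symm _ hA2, ← integral_add hA1 hA2, ← integral_prod_mul]
  refine integral_congr_ae (Eventually.of_forall fun x => ?_)
  exact (congrFun (indicator_self_add_compl {x : ℝ × ℝ | x.2 < x.1}
    fun x : ℝ × ℝ => f x.1 * e x.2) x).symm

/-- `F` is on `(0, Y]` the primitive of the complex measure `f dμ + k dt`, with initial
value `F₀`. -/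
structure Primitive (μ : Measure ℝ) (Y : ℝ) (F₀ : ℂ) (f k F : ℝ → ℂ) : Prop where
  intf : IntegrableOn f (Ioc 0 Y) μ
  intk : IntegrableOn k (Ioc 0 Y)
  eq : ∀ y ∈ Ioc 0 Y, F y = F₀ + (∫ s in Ioc 0 y, f s ∂μ) + ∫ t in Ioc 0 y, k t

namespace Primitive

variable {μ : Measure ℝ} {Y : ℝ} {F₀ E₀ : ℂ} {f k F e E : ℝ → ℂ}

theorem mono (h : Primitive μ Y F₀ f k F) {y : ℝ} (hy : y ≤ Y) : Primitive μ y F₀ f k F where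
  intf := h.intf.mono_set (Ioc_subset_Ioc_right hy)
  intk := h.intk.mono_set (Ioc_subset_Ioc_right hy)
  eq x hx := h.eq x ⟨hx.1, hx.2.trans hy⟩

theorem congr (h : Primitive μ Y F₀ f k F) {f' k' F' : ℝ → ℂ} (hf : ∀ y ∈ Ioc 0 Y, f y = f' y)
    (hk : ∀ y ∈ Ioc 0 Y, k y = k' y) (hF : ∀ y ∈ Ioc 0 Y, F y = F' y) :
    Primitive μ Y F₀ f' k' F' where
  intf := h.intf.congr_fun hf measurableSet_Ioc
  intk := h.intk.congr_fun hk measurableSet_Ioc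
  eq y hy := by
    rw [← hF y hy, h.eq y hy]
    congr 1
    · congr 1
      exact setIntegral_congr_fun measurableSet_Ioc fun s hs => hf s ⟨hs.1, hs.2.trans hy.2⟩
    · exact setIntegral_congr_fun measurableSet_Ioc fun s hs => hk s ⟨hs.1, hs.2.trans hy.2⟩

theorem add (h : Primitive μ Y F₀ f k F) {f' k' F' : ℝ → ℂ} (h' : Primitive μ Y E₀ f' k' F') :
    Primitive μ Y (F₀ + E₀) (fun y => f y + f' y) (fun y => k y + k' y) (fun y => F y + F' y) where
  intf := h.intf.add h'.intf
  intk := h.intk.add h'.intk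
  eq y hy := by
    have m := h.mono hy.2
    have m' := h'.mono hy.2
    rw [h.eq y hy, h'.eq y hy, integral_add m.intf m'.intf, integral_add m.intk m'.intk]
    ring

theorem const_mul (h : Primitive μ Y F₀ f k F) (c : ℂ) :
    Primitive μ Y (c * F₀) (fun y => c * f y) (fun y => c * k y) (fun y => c * F y) where
  intf := h.intf.const_mul c
  intk := h.intk.const_mul c
  eq y hy := by
    rw [h.eq y hy, integral_const_mul, integral_const_mul]
    ring

theorem conj (h : Primitive μ Y F₀ f k F) :
    Primitive μ Y (star F₀) (fun y => star (f y)) (fun y => star (k y)) (fun y => star (F y)) where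
  intf := by
    have := h.intf
    exact (Complex.conjLIE.toContinuousLinearEquiv.toContinuousLinearMap).integrable_comp this
  intk := (Complex.conjLIE.toContinuousLinearEquiv.toContinuousLinearMap).integrable_comp h.intk
  eq y hy := by
    rw [h.eq y hy, star_add, star_add]
    congr 1
    · congr 1
      exact (integral_conj (f := f)).symm
    · exact (integral_conj (f := k)).symm

/-- The product rule. -/
theorem mul (hμ : μ (Ioc 0 Y) < ⊤) (h : Primitive μ Y F₀ f k F)
    (h' : Primitive μ Y E₀ (fun _ => 0) e E) :
    Primitive μ Y (F₀ * E₀) (fun y => f y * E y) (fun y => k y * E y + e y * F y)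
      (fun y => F y * E y) := by
  have hE : ∀ y ∈ Ioc 0 Y, E y = E₀ + ∫ t in Ioc 0 y, e t := by
    intro y hy
    simpa using h'.eq y hy
  have hfin : (volume : Measure ℝ) (Ioc 0 Y) < ⊤ := measure_Ioc_lt_top
  have key : ∀ y ∈ Icc 0 Y, IntegrableOn (fun y => f y * E y) (Ioc 0 y) μ ∧
      IntegrableOn (fun y => k y * E y + e y * F y) (Ioc 0 y) ∧
      ((∫ s in Ioc 0 y, f s ∂μ) * (∫ t in Ioc 0 y, e t) + (∫ s in Ioc 0 y, k s) * (∫ t in Ioc 0 y, e t)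
        = (∫ s in Ioc 0 y, f s * E s ∂μ) + (∫ t in Ioc 0 y, (k t * E t + e t * F t))
          - E₀ * (∫ s in Ioc 0 y, f s ∂μ) - E₀ * (∫ s in Ioc 0 y, k s)
          - F₀ * ∫ t in Ioc 0 y, e t) := by
    intro y hy
    have m := h.mono hy.2
    have m' := h'.mono hy.2
    have hμy : μ (Ioc 0 y) < ⊤ := (measure_mono (Ioc_subset_Ioc_right hy.2)).trans_lt hμ
    obtain ⟨a1, a2, a3⟩ := setIntegral_mul_setIntegral hμy m.intf m'.intk
    obtain ⟨b1, b2, b3⟩ := setIntegral_mul_setIntegral (measure_Ioc_lt_top (μ := volume)) m.intk m'.intk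
    have cf : EqOn (fun s => E₀ * f s + f s * ∫ t in Ioc 0 s, e t) (fun s => f s * E s) (Ioc 0 y) := by
      intro s hs
      simp only [hE s ⟨hs.1, hs.2.trans hy.2⟩]
      ring
    have ck : EqOn (fun s => (E₀ * k s + k s * ∫ t in Ioc 0 s, e t) +
        (F₀ * e s + e s * (∫ t in Ioc 0 s, f t ∂μ) + e s * ∫ t in Ioc 0 s, k t))
        (fun s => k s * E s + e s * F s) (Ioc 0 y) := by
      intro s hs
      have hs' : s ∈ Ioc 0 Y := ⟨hs.1, hs.2.trans hy.2⟩
      simp only [hE s hs', h.eq s hs']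
      ring
    have if1 : IntegrableOn (fun s => E₀ * f s) (Ioc 0 y) μ := m.intf.const_mul _
    have ik1 : IntegrableOn (fun s => E₀ * k s) (Ioc 0 y) := m.intk.const_mul _
    have ie1 : IntegrableOn (fun s => F₀ * e s) (Ioc 0 y) := m'.intk.const_mul _
    have s1 : IntegrableOn (fun s => E₀ * k s + k s * ∫ t in Ioc 0 s, e t) (Ioc 0 y) := ik1.add b1
    have s2 : IntegrableOn (fun s => F₀ * e s + e s * ∫ t in Ioc 0 s, f t ∂μ) (Ioc 0 y) :=
      ie1.add a2
    have s3 : IntegrableOn (fun s => F₀ * e s + e s * (∫ t in Ioc 0 s, f t ∂μ) +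
        e s * ∫ t in Ioc 0 s, k t) (Ioc 0 y) := s2.add b2
    refine ⟨(if1.add a1).congr_fun cf measurableSet_Ioc,
      (s1.add s3).congr_fun ck measurableSet_Ioc, ?_⟩
    rw [← setIntegral_congr_fun measurableSet_Ioc cf, ← setIntegral_congr_fun measurableSet_Ioc ck,
      integral_add if1 a1, integral_add s1 s3, integral_add ik1 b1,
      integral_add s2 b2, integral_add ie1 a2, a3, b3, integral_const_mul,
      integral_const_mul, integral_const_mul]
    ring
  refine ⟨?_, ?_, fun y hy => ?_⟩
  · by_cases hY : 0 ≤ Y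
    · exact (key Y ⟨hY, le_rfl⟩).1
    · simp [Ioc_eq_empty (fun h : 0 < Y => hY h.le)]
  · by_cases hY : 0 ≤ Y
    · exact (key Y ⟨hY, le_rfl⟩).2.1
    · simp [Ioc_eq_empty (fun h : 0 < Y => hY h.le)]
  · have := (key y ⟨hy.1.le, hy.2⟩).2.2
    rw [h.eq y hy, hE y hy]
    linear_combination this

/-- The real part of a primitive. -/
theorem re_eq (h : Primitive μ Y F₀ f k F) {y : ℝ} (hy : y ∈ Ioc 0 Y) :
    (F y).re = F₀.re + (∫ s in Ioc 0 y, (f s).re ∂μ) + ∫ t in Ioc 0 y, (k t).re := by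
  have m := h.mono hy.2
  rw [h.eq y hy, Complex.add_re, Complex.add_re]
  congr 1
  · congr 1
    exact (integral_re m.intf).symm
  · exact (integral_re m.intk).symm

end Primitive

theorem continuousOn_setIntegral_Ioc {e : ℝ → ℂ} {Y : ℝ} (he : IntegrableOn e (Ioc 0 Y)) :
    ContinuousOn (fun y => ∫ t in Ioc 0 y, e t) (Icc 0 Y) :=
  intervalIntegral.continuousOn_primitive ((integrableOn_Icc_iff_integrableOn_Ioc).2 he)

/-- Post-composition of a real absolutely continuous function with the exponential. -/
theorem AbsolutelyContinuousOnInterval.exp {g : ℝ → ℝ} {x y : ℝ}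
    (hg : AbsolutelyContinuousOnInterval g x y) :
    AbsolutelyContinuousOnInterval (fun t => Real.exp (g t)) x y := by
  obtain ⟨C, hC⟩ := hg.exists_bound
  have hK : 0 < Real.exp C := Real.exp_pos C
  have hlip : ∀ s ∈ uIcc x y, ∀ t ∈ uIcc x y,
      dist (Real.exp (g s)) (Real.exp (g t)) ≤ Real.exp C * dist (g s) (g t) := by
    intro s hs t ht
    rw [dist_eq_norm, dist_eq_norm]
    refine (convex_Iic C).norm_image_sub_le_of_norm_deriv_le (𝕜 := ℝ) (f := Real.exp)
      (fun u _ => Real.differentiable_exp u) (fun u hu => ?_)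
      ((le_abs_self _).trans (hC t ht)) ((le_abs_self _).trans (hC s hs))
    rw [Real.deriv_exp, Real.norm_eq_abs, Real.abs_exp]
    exact Real.exp_le_exp.2 hu
  rw [absolutelyContinuousOnInterval_iff] at hg ⊢
  intro ε hε
  obtain ⟨δ, hδ, h⟩ := hg (ε / Real.exp C) (by positivity)
  refine ⟨δ, hδ, fun E hE hlen => ?_⟩
  have h1 := h E hE hlen
  rw [lt_div_iff₀ hK, mul_comm, Finset.mul_sum] at h1
  refine lt_of_le_of_lt (Finset.sum_le_sum fun i hi => ?_) h1
  have := hE.1 i hi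
  exact hlip _ this.1 _ this.2

/-- The exponential of the primitive of an integrable function. -/
theorem exp_setIntegral_Ioc {γ : ℝ → ℝ} {Y : ℝ} (hY : 0 ≤ Y) (hγ : IntegrableOn γ (Ioc 0 Y)) :
    IntegrableOn (fun t => γ t * Real.exp (∫ s in Ioc 0 t, γ s)) (Ioc 0 Y) ∧
      Real.exp (∫ s in Ioc 0 Y, γ s)
        = 1 + ∫ t in Ioc 0 Y, γ t * Real.exp (∫ s in Ioc 0 t, γ s) := by
  have hint : IntervalIntegrable γ volume 0 Y := (intervalIntegrable_iff_integrableOn_Ioc_of_le hY).2 hγ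
  have hac := (hint.absolutelyContinuousOnInterval_intervalIntegral (c := 0) (by simp)).exp
  have hder : ∀ᵐ t, t ∈ Ioc 0 Y → deriv (fun t => Real.exp (∫ s in (0 : ℝ)..t, γ s)) t
      = γ t * Real.exp (∫ s in Ioc 0 t, γ s) := by
    filter_upwards [hint.ae_hasDerivAt_integral] with t ht htY
    have h1 := (ht (by rw [uIcc_of_le hY]; exact Ioc_subset_Icc_self htY) 0 (by simp)).exp.deriv
    rw [h1, intervalIntegral.integral_of_le htY.1.le, mul_comm]
  have hder' := (ae_restrict_iff' (μ := volume) measurableSet_Ioc).2 hder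
  have hi := (intervalIntegrable_iff_integrableOn_Ioc_of_le hY).1 hac.intervalIntegrable_deriv
  refine ⟨hi.congr hder', ?_⟩
  have h := (intervalIntegral.integral_of_le hY).symm.trans hac.integral_deriv_eq_sub
  rw [← integral_congr_ae hder', h, intervalIntegral.integral_of_le hY]
  simp

/-- Coefficients of the expansion in powers of `z` of the derivative of the solution of
`φ″ = z² φ μ − 2 i z b φ′`, `φ(0) = p`, `φ′(0⁺) = q`. -/
def seriesCoeff (μ : Measure ℝ) (b : ℝ → ℝ) (p q : ℂ) : ℕ → ℝ → ℂ
  | 0 => fun _ => q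
  | 1 => fun y => -2 * Complex.I * ∫ t in Ioc 0 y, (b t : ℂ) * q
  | k + 2 => fun y => -2 * Complex.I * (∫ t in Ioc 0 y, (b t : ℂ) * seriesCoeff μ b p q (k + 1) t) +
      ∫ s in Ioc 0 y, ((if k = 0 then p else 0) + ∫ t in Ioc 0 s, seriesCoeff μ b p q k t) ∂μ

section Series

variable {μ : Measure ℝ} {b : ℝ → ℝ} {p q : ℂ} {Y : ℝ}

theorem integrableOn_const_add_primitive (hμ : μ (Ioc 0 Y) < ⊤) {u : ℝ → ℂ} (c : ℂ)
    (hu : IntegrableOn u (Ioc 0 Y)) :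
    IntegrableOn (fun s => c + ∫ t in Ioc 0 s, u t) (Ioc 0 Y) μ := by
  have hc : ∀ c : ℂ, IntegrableOn (fun _ : ℝ => c) (Ioc 0 Y) μ :=
    fun c => integrableOn_const hμ.ne
  have h1 := (setIntegral_mul_setIntegral hμ (hc 1) hu).1
  simp only [one_mul] at h1
  exact (hc c).add h1

theorem integrableOn_mul_seriesCoeff (hμ : μ (Ioc 0 Y) < ⊤)
    (hb : IntegrableOn (fun t => (b t : ℂ)) (Ioc 0 Y)) : ∀ (k : ℕ) {e : ℝ → ℂ},
    IntegrableOn e (Ioc 0 Y) → IntegrableOn (fun t => e t * seriesCoeff μ b p q k t) (Ioc 0 Y)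
  | 0, e, he => by
    simp only [seriesCoeff]
    exact he.mul_const q
  | 1, e, he => by
    simp only [seriesCoeff]
    have := (setIntegral_mul_setIntegral (measure_Ioc_lt_top (μ := volume)) (hb.mul_const q) he).2.1
    refine (this.const_mul (-2 * Complex.I)).congr (Eventually.of_forall fun t => ?_)
    simp only
    ring
  | k + 2, e, he => by
    simp only [seriesCoeff]
    have h1 := integrableOn_mul_seriesCoeff hμ hb (k + 1) hb
    have h0 : IntegrableOn (seriesCoeff μ b p q k) (Ioc 0 Y) := by
      have h1 : IntegrableOn (fun _ => (1 : ℂ)) (Ioc 0 Y) := integrableOn_const (by simp)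
      simpa using integrableOn_mul_seriesCoeff hμ hb k h1
    have i1 := (setIntegral_mul_setIntegral (measure_Ioc_lt_top (μ := volume)) h1 he).2.1
    have i2 := (setIntegral_mul_setIntegral hμ
      (integrableOn_const_add_primitive hμ (if k = 0 then p else 0) h0) he).2.1
    refine ((i1.const_mul (-2 * Complex.I)).add i2).congr (Eventually.of_forall fun t => ?_)
    simp only [Pi.add_apply]
    ring

theorem integrableOn_seriesCoeff (hμ : μ (Ioc 0 Y) < ⊤)
    (hb : IntegrableOn (fun t => (b t : ℂ)) (Ioc 0 Y)) (k : ℕ) :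
    IntegrableOn (seriesCoeff μ b p q k) (Ioc 0 Y) := by
  have h1 : IntegrableOn (fun _ => (1 : ℂ)) (Ioc 0 Y) := integrableOn_const (by simp)
  simpa using integrableOn_mul_seriesCoeff (p := p) (q := q) hμ hb k h1

/-- The coefficients decay faster than any geometric sequence, locally uniformly. -/
theorem exists_norm_seriesCoeff_le (hμ : μ (Ioc 0 Y) < ⊤)
    (hb : IntegrableOn b (Ioc 0 Y)) {ε : ℝ} (hε : 0 < ε) (hε1 : ε ≤ 1) :
    ∃ D, 0 ≤ D ∧ ∀ k, ∀ y ∈ Ioc 0 Y, ‖seriesCoeff μ b p q k y‖ ≤ D * ε ^ k := by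
  rcases lt_or_ge 0 Y with hY | hY
  swap
  · exact ⟨0, le_rfl, fun k y hy => absurd (hy.1.trans_le hy.2) (not_lt.2 hY)⟩
  set m := μ.real (Ioc 0 Y) with hm
  have hm0 : 0 ≤ m := measureReal_nonneg
  set γ : ℝ → ℝ := fun t => 2 * |b t| + m with hγ
  have hγ0 : ∀ t, 0 ≤ γ t := fun t => by positivity
  have hγi : IntegrableOn γ (Ioc 0 Y) := (hb.abs.const_mul 2).add (integrableOn_const (by simp))
  set l := 2 / ε ^ 2 with hl
  have hl0 : 0 < l := by positivity
  set W : ℝ → ℝ := fun y => Real.exp (∫ t in Ioc 0 y, l * γ t) with hW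
  have hW1 : ∀ y, 1 ≤ W y := fun y =>
    Real.one_le_exp (setIntegral_nonneg measurableSet_Ioc fun t _ => mul_nonneg hl0.le (hγ0 t))
  have hexp : ∀ y ∈ Ioc 0 Y, IntegrableOn (fun t => γ t * W t) (Ioc 0 y) ∧
      ∫ t in Ioc 0 y, γ t * W t ≤ W y * (ε ^ 2 / 2) := by
    intro y hy
    obtain ⟨h1, h2⟩ := exp_setIntegral_Ioc hy.1.le
      ((hγi.mono_set (Ioc_subset_Ioc_right hy.2)).const_mul l)
    have h3 : IntegrableOn (fun t => γ t * W t) (Ioc 0 y) := by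
      refine (h1.const_mul l⁻¹).congr (Eventually.of_forall fun t => ?_)
      simp only [hW]
      field_simp
    refine ⟨h3, ?_⟩
    have h4 : ∫ t in Ioc 0 y, l * γ t * W t = l * ∫ t in Ioc 0 y, γ t * W t := by
      rw [← integral_const_mul]
      simp only [mul_assoc]
    change W y = 1 + ∫ t in Ioc 0 y, l * γ t * W t at h2
    rw [h4] at h2
    have h5 : ∫ t in Ioc 0 y, γ t * W t = (W y - 1) * (ε ^ 2 / 2) := by
      rw [h2, hl]
      field_simp
      ring
    rw [h5]
    gcongr
    linarith
  set C := ‖q‖ + 2 * m * ‖p‖ / ε ^ 2 with hC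
  have hC0 : 0 ≤ C := by positivity
  have hqC : ‖q‖ ≤ C := le_add_of_nonneg_right (by positivity)
  have hpC : m * ‖p‖ ≤ C * (ε ^ 2 / 2) := by
    have : m * ‖p‖ = (2 * m * ‖p‖ / ε ^ 2) * (ε ^ 2 / 2) := by field_simp
    rw [this]
    gcongr
    exact le_add_of_nonneg_left (norm_nonneg q)
  have hbC : IntegrableOn (fun t => (b t : ℂ)) (Ioc 0 Y) := hb.ofReal
  have hWmono : ∀ y ∈ Ioc 0 Y, W y ≤ W Y := by
    intro y hy
    refine Real.exp_le_exp.2 (setIntegral_mono_set (hγi.const_mul l) ?_ ?_)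
    · exact Eventually.of_forall fun t => mul_nonneg hl0.le (hγ0 t)
    · exact (Ioc_subset_Ioc_right hy.2).eventuallyLE
  have hWc : ContinuousOn W (Icc 0 Y) := (intervalIntegral.continuousOn_primitive
    ((integrableOn_Icc_iff_integrableOn_Ioc).2 (hγi.const_mul l))).rexp
  have hmulW : ∀ g : ℝ → ℝ, IntegrableOn g (Ioc 0 Y) → IntegrableOn (fun t => g t * W t) (Ioc 0 Y) :=
    fun g hg => (((integrableOn_Icc_iff_integrableOn_Ioc).2 hg).mul_continuousOn hWc
      isCompact_Icc).mono_set Ioc_subset_Icc_self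
  have hWb : IntegrableOn (fun t => 2 * |b t| * W t) (Ioc 0 Y) := hmulW _ (hb.abs.const_mul 2)
  have hWm : IntegrableOn (fun t => m * W t) (Ioc 0 Y) :=
    hmulW _ (integrableOn_const (by simp))
  have hWi : IntegrableOn W (Ioc 0 Y) := by
    simpa using hmulW _ (integrableOn_const (C := (1 : ℝ)) (by simp))
  have key : ∀ k, ∀ y ∈ Ioc 0 Y, ‖seriesCoeff μ b p q k y‖ ≤ C * ε ^ k * W y := by
    intro k
    induction k using Nat.strong_induction_on with
    | _ k ih =>
    intro y hy
    have hsub : Ioc 0 y ⊆ Ioc 0 Y := Ioc_subset_Ioc_right hy.2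
    obtain ⟨hi, hle⟩ := hexp y hy
    have hWy := hW1 y
    match k with
    | 0 =>
      simp only [seriesCoeff, pow_zero, mul_one]
      nlinarith
    | 1 =>
      simp only [seriesCoeff, pow_one]
      have h1 : ‖∫ t in Ioc 0 y, (b t : ℂ) * q‖ ≤ ∫ t in Ioc 0 y, C / 2 * (γ t * W t) := by
        refine norm_integral_le_of_norm_le (hi.const_mul _) (Eventually.of_forall fun t => ?_)
        have e1 : |b t| * ‖q‖ ≤ γ t / 2 * C := by
          gcongr
          simp only [hγ]
          linarith
        have e2 : γ t / 2 * C ≤ γ t / 2 * C * W t :=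
          le_mul_of_one_le_right (by have := hγ0 t; positivity) (hW1 t)
        calc ‖(b t : ℂ) * q‖ = |b t| * ‖q‖ := by simp
          _ ≤ C / 2 * (γ t * W t) := by linarith
      rw [integral_const_mul] at h1
      have h2 : ‖-2 * Complex.I * ∫ t in Ioc 0 y, (b t : ℂ) * q‖
          ≤ C * (W y * (ε ^ 2 / 2)) := by
        rw [norm_mul]
        have : ‖-2 * Complex.I‖ = 2 := by simp
        rw [this]
        have := mul_le_mul_of_nonneg_left hle hC0
        linarith
      refine h2.trans ?_
      have : ε ^ 2 / 2 ≤ ε := by nlinarith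
      calc C * (W y * (ε ^ 2 / 2)) ≤ C * (W y * ε) := by gcongr
        _ = C * ε * W y := by ring
    | k + 2 =>
      simp only [seriesCoeff]
      have h1 : ‖-2 * Complex.I * ∫ t in Ioc 0 y, (b t : ℂ) * seriesCoeff μ b p q (k + 1) t‖
          ≤ ∫ t in Ioc 0 y, C * ε ^ k * (2 * |b t| * W t) := by
        rw [← integral_const_mul]
        refine norm_integral_le_of_norm_le ?_ ((ae_restrict_iff' measurableSet_Ioc).2
          (Eventually.of_forall fun t ht => ?_))
        · exact (hWb.mono_set hsub).const_mul _
        · have e := ih (k + 1) (by omega) t (hsub ht)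
          have e2 : C * ε ^ (k + 1) * W t ≤ C * ε ^ k * W t := by
            have := hW1 t
            gcongr ?_ * _
            rw [pow_succ]
            gcongr
            exact mul_le_of_le_one_right (by positivity) hε1
          calc ‖-2 * Complex.I * ((b t : ℂ) * seriesCoeff μ b p q (k + 1) t)‖
              = 2 * |b t| * ‖seriesCoeff μ b p q (k + 1) t‖ := by simp [mul_assoc]
            _ ≤ 2 * |b t| * (C * ε ^ k * W t) := by gcongr; exact e.trans e2
            _ = C * ε ^ k * (2 * |b t| * W t) := by ring
      have h2 : ‖∫ s in Ioc 0 y, ((if k = 0 then p else 0) +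
          ∫ t in Ioc 0 s, seriesCoeff μ b p q k t) ∂μ‖
          ≤ C * ε ^ (k + 2) / 2 + ∫ t in Ioc 0 y, C * ε ^ k * (m * W t) := by
        have hA : ∀ s ∈ Ioc 0 y, ‖(if k = 0 then p else 0) +
            ∫ t in Ioc 0 s, seriesCoeff μ b p q k t‖
            ≤ (if k = 0 then ‖p‖ else 0) + ∫ t in Ioc 0 y, C * ε ^ k * W t := by
          intro s hs
          have hss : Ioc 0 s ⊆ Ioc 0 y := Ioc_subset_Ioc_right hs.2
          refine (norm_add_le _ _).trans (add_le_add (by split_ifs <;> simp) ?_)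
          refine (norm_integral_le_of_norm_le (((hWi.mono_set hsub).mono_set hss).const_mul _)
            ((ae_restrict_iff' measurableSet_Ioc).2 (Eventually.of_forall fun t ht =>
              ih k (by omega) t (hsub (hss ht))))).trans ?_
          refine setIntegral_mono_set ((hWi.mono_set hsub).const_mul _)
            (Eventually.of_forall fun t => ?_) hss.eventuallyLE
          have := hW1 t
          simp only [Pi.zero_apply]
          positivity
        have hμy : μ (Ioc 0 y) < ⊤ := (measure_mono hsub).trans_lt hμ
        have hB0 : 0 ≤ ∫ t in Ioc 0 y, C * ε ^ k * W t :=
          setIntegral_nonneg measurableSet_Ioc fun t _ => by have := hW1 t; positivity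
        have hmy : μ.real (Ioc 0 y) ≤ m := measureReal_mono hsub hμ.ne
        have hp : (if k = 0 then ‖p‖ else 0) * m ≤ C * ε ^ (k + 2) / 2 := by
          split_ifs with h
          · subst h
            simp only [zero_add]
            linarith
          · rw [zero_mul]
            positivity
        calc _ ≤ ((if k = 0 then ‖p‖ else 0) + ∫ t in Ioc 0 y, C * ε ^ k * W t)
              * μ.real (Ioc 0 y) := norm_setIntegral_le_of_norm_le_const hμy hA
          _ ≤ ((if k = 0 then ‖p‖ else 0) + ∫ t in Ioc 0 y, C * ε ^ k * W t) * m := by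
            gcongr
          _ = (if k = 0 then ‖p‖ else 0) * m + ∫ t in Ioc 0 y, C * ε ^ k * (m * W t) := by
            rw [add_mul, ← integral_mul_const]
            congr 1
            refine integral_congr_ae (Eventually.of_forall fun t => ?_)
            simp only
            ring
          _ ≤ _ := by gcongr
      have h3 : (∫ t in Ioc 0 y, C * ε ^ k * (2 * |b t| * W t)) +
          ∫ t in Ioc 0 y, C * ε ^ k * (m * W t) = C * ε ^ k * ∫ t in Ioc 0 y, γ t * W t := by
        rw [← integral_add ((hWb.mono_set hsub).const_mul _) ((hWm.mono_set hsub).const_mul _),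
          ← integral_const_mul]
        refine integral_congr_ae (Eventually.of_forall fun t => ?_)
        simp only [hγ]
        ring
      have h4 := mul_le_mul_of_nonneg_left hle (by positivity : 0 ≤ C * ε ^ k)
      have h5 : C * ε ^ (k + 2) / 2 ≤ C * ε ^ (k + 2) / 2 * W y :=
        le_mul_of_one_le_right (by positivity) hWy
      calc _ ≤ _ := norm_add_le _ _
        _ ≤ _ := add_le_add h1 h2
        _ ≤ C * ε ^ (k + 2) / 2 * W y + C * ε ^ k * (W y * (ε ^ 2 / 2)) := by linarith
        _ = C * ε ^ (k + 2) * W y := by ring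
  refine ⟨C * W Y, by have := hW1 Y; positivity, fun k y hy => (key k y hy).trans ?_⟩
  calc C * ε ^ k * W y ≤ C * ε ^ k * W Y := by gcongr; exact hWmono y hy
    _ = C * W Y * ε ^ k := by ring

end Series

/-- Termwise integration of a series of functions with a geometric bound. -/
theorem hasSum_setIntegral_of_geometric {ν : Measure ℝ} {S : Set ℝ} (hS : MeasurableSet S)
    {e : ℝ → ℂ} (he : IntegrableOn e S ν) {F : ℕ → ℝ → ℂ} {D : ℝ}
    (hF : ∀ k, IntegrableOn (fun t => e t * F k t) S ν)
    (hle : ∀ k, ∀ t ∈ S, ‖F k t‖ ≤ D * (1 / 2) ^ k) :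
    IntegrableOn (fun t => e t * ∑' k, F k t) S ν ∧
      HasSum (fun k => ∫ t in S, e t * F k t ∂ν) (∫ t in S, e t * ∑' k, F k t ∂ν) := by
  have hgeo : Summable fun k : ℕ => D * (1 / 2 : ℝ) ^ k := summable_geometric_two.mul_left D
  have hsum : ∀ t ∈ S, HasSum (fun k => F k t) (∑' k, F k t) := fun t ht =>
    (Summable.of_norm_bounded hgeo fun k => hle k t ht).hasSum
  have hsum' : ∀ᵐ t ∂ν.restrict S, HasSum (fun k => e t * F k t) (e t * ∑' k, F k t) :=
    (ae_restrict_iff' hS).2 (Eventually.of_forall fun t ht => (hsum t ht).mul_left (e t))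
  have hmeas : AEStronglyMeasurable (fun t => e t * ∑' k, F k t) (ν.restrict S) := by
    refine aestronglyMeasurable_of_tendsto_ae (u := atTop)
      (f := fun n t => ∑ k ∈ Finset.range n, e t * F k t) (fun n => ?_) ?_
    · have : AEStronglyMeasurable (∑ k ∈ Finset.range n, fun t => e t * F k t) (ν.restrict S) :=
        Finset.aestronglyMeasurable_sum _ fun k _ => (hF k).aestronglyMeasurable
      refine this.congr (Eventually.of_forall fun t => ?_)
      simp
    · exact hsum'.mono fun t ht => ht.tendsto_sum_nat
  have hbd : ∀ k, ∀ᵐ t ∂ν.restrict S, ‖e t * F k t‖ ≤ ‖e t‖ * (D * (1 / 2) ^ k) := fun k =>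
    (ae_restrict_iff' hS).2 (Eventually.of_forall fun t ht => by
      rw [norm_mul]; gcongr; exact hle k t ht)
  have htot : ∀ t, ∑' k : ℕ, ‖e t‖ * (D * (1 / 2 : ℝ) ^ k) = ‖e t‖ * (D * 2) := fun t => by
    rw [tsum_mul_left, tsum_mul_left, tsum_geometric_two]
  refine ⟨(he.norm.mul_const (D * 2)).mono' hmeas ((ae_restrict_iff' hS).2
    (Eventually.of_forall fun t ht => ?_)), ?_⟩
  · rw [norm_mul, ← tsum_geometric_two, ← tsum_mul_left]
    gcongr
    exact tsum_of_norm_bounded hgeo.hasSum fun k => hle k t ht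
  · refine hasSum_integral_of_dominated_convergence (fun k t => ‖e t‖ * (D * (1 / 2) ^ k))
      (fun k => (hF k).aestronglyMeasurable) hbd
      (Eventually.of_forall fun t => hgeo.mul_left _) ?_ hsum'
    simp only [htot]
    exact he.norm.mul_const _

/-- The derivative of the solution of `φ″ = z² φ μ − 2 i z b φ′`, `φ(0) = p`, `φ′(0⁺) = q`. -/
def seriesSlope (μ : Measure ℝ) (b : ℝ → ℝ) (p q z : ℂ) (y : ℝ) : ℂ :=
  ∑' k, z ^ k * seriesCoeff μ b p q k y

/-- The solution of `φ″ = z² φ μ − 2 i z b φ′`, `φ(0) = p`, `φ′(0⁺) = q`. -/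
def seriesSolution (μ : Measure ℝ) (b : ℝ → ℝ) (p q z : ℂ) (y : ℝ) : ℂ :=
  p + ∫ t in Ioc 0 y, seriesSlope μ b p q z t

section Series

variable {μ : Measure ℝ} {b : ℝ → ℝ} {p q : ℂ} {Y : ℝ}

theorem exists_norm_pow_mul_seriesCoeff_le (hμ : μ (Ioc 0 Y) < ⊤) (hb : IntegrableOn b (Ioc 0 Y))
    {r : ℝ} (hr : 0 ≤ r) : ∃ D, 0 ≤ D ∧ ∀ z : ℂ, ‖z‖ ≤ r → ∀ k, ∀ y ∈ Ioc 0 Y,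
      ‖z ^ k * seriesCoeff μ b p q k y‖ ≤ D * (1 / 2) ^ k := by
  obtain ⟨D, hD, h⟩ := exists_norm_seriesCoeff_le (p := p) (q := q) hμ hb
    (ε := 1 / (2 * (r + 1))) (by positivity) (by rw [div_le_one (by positivity)]; linarith)
  refine ⟨D, hD, fun z hz k y hy => ?_⟩
  have h1 : ‖z‖ * (1 / (2 * (r + 1))) ≤ 1 / 2 := by
    rw [mul_one_div, div_le_iff₀ (by positivity)]
    linarith
  calc ‖z ^ k * seriesCoeff μ b p q k y‖ ≤ ‖z‖ ^ k * (D * (1 / (2 * (r + 1))) ^ k) := by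
        rw [norm_mul, norm_pow]
        gcongr
        exact h k y hy
    _ = D * (‖z‖ * (1 / (2 * (r + 1)))) ^ k := by rw [mul_pow]; ring
    _ ≤ D * (1 / 2) ^ k := by gcongr

theorem hasSum_mul_seriesSlope (hμ : μ (Ioc 0 Y) < ⊤) (hb : IntegrableOn b (Ioc 0 Y)) (z : ℂ)
    {e : ℝ → ℂ} (he : IntegrableOn e (Ioc 0 Y)) :
    IntegrableOn (fun t => e t * seriesSlope μ b p q z t) (Ioc 0 Y) ∧
      HasSum (fun k => z ^ k * ∫ t in Ioc 0 Y, e t * seriesCoeff μ b p q k t)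
        (∫ t in Ioc 0 Y, e t * seriesSlope μ b p q z t) := by
  obtain ⟨D, -, h⟩ := exists_norm_pow_mul_seriesCoeff_le (p := p) (q := q) hμ hb (norm_nonneg z)
  have hi := fun k => integrableOn_mul_seriesCoeff (b := b) (p := p) (q := q) hμ hb.ofReal k he
  obtain ⟨h1, h2⟩ := hasSum_setIntegral_of_geometric (F := fun k t => z ^ k * seriesCoeff μ b p q k t)
    measurableSet_Ioc he
    (fun k => ((hi k).const_mul (z ^ k)).congr (Eventually.of_forall fun t => mul_left_comm _ _ _))
    (h z le_rfl)
  refine ⟨h1, h2.congr_fun fun k => ?_⟩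
  rw [← integral_const_mul]
  simp only [mul_left_comm]

theorem integrableOn_seriesSlope (hμ : μ (Ioc 0 Y) < ⊤) (hb : IntegrableOn b (Ioc 0 Y)) (z : ℂ) :
    IntegrableOn (seriesSlope μ b p q z) (Ioc 0 Y) := by
  have h1 : IntegrableOn (fun _ => (1 : ℂ)) (Ioc 0 Y) := integrableOn_const (by simp)
  simpa using (hasSum_mul_seriesSlope (p := p) (q := q) hμ hb z h1).1

theorem hasSum_seriesSolution (hμ : μ (Ioc 0 Y) < ⊤) (hb : IntegrableOn b (Ioc 0 Y)) (z : ℂ) :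
    HasSum (fun k => z ^ k * ((if k = 0 then p else 0) +
      ∫ t in Ioc 0 Y, seriesCoeff μ b p q k t)) (seriesSolution μ b p q z Y) := by
  have h1 : IntegrableOn (fun _ => (1 : ℂ)) (Ioc 0 Y) := integrableOn_const (by simp)
  have h := (hasSum_mul_seriesSlope (p := p) (q := q) hμ hb z h1).2
  simp only [one_mul] at h
  refine ((hasSum_ite_eq 0 p).add h).congr_fun fun k => ?_
  rw [mul_add]
  split_ifs with hk <;> simp [hk]

theorem exists_norm_pow_mul_seriesSolution_coeff_le (hμ : μ (Ioc 0 Y) < ⊤)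
    (hb : IntegrableOn b (Ioc 0 Y)) {r : ℝ} (hr : 0 ≤ r) :
    ∃ D, 0 ≤ D ∧ ∀ z : ℂ, ‖z‖ ≤ r → ∀ k, ∀ y ∈ Ioc 0 Y,
      ‖z ^ k * ((if k = 0 then p else 0) + ∫ t in Ioc 0 y, seriesCoeff μ b p q k t)‖
        ≤ D * (1 / 2) ^ k := by
  obtain ⟨D, hD, h⟩ := exists_norm_pow_mul_seriesCoeff_le (p := p) (q := q) hμ hb hr
  refine ⟨‖p‖ + D * |Y|, by positivity, fun z hz k y hy => ?_⟩
  have h1 : ‖z ^ k * (if k = 0 then p else 0)‖ ≤ ‖p‖ * (1 / 2) ^ k := by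
    split_ifs with hk
    · simp [hk]
    · simp
  have h2 : ‖∫ t in Ioc 0 y, z ^ k * seriesCoeff μ b p q k t‖
      ≤ D * (1 / 2) ^ k * volume.real (Ioc 0 y) :=
    norm_setIntegral_le_of_norm_le_const measure_Ioc_lt_top
      fun t ht => h z hz k t ⟨ht.1, ht.2.trans hy.2⟩
  rw [mul_add, ← integral_const_mul]
  have h3 : volume.real (Ioc 0 y) ≤ |Y| := by
    rw [Real.volume_real_Ioc_of_le hy.1.le]
    linarith [hy.2, le_abs_self Y]
  calc _ ≤ _ := norm_add_le _ _
    _ ≤ ‖p‖ * (1 / 2) ^ k + D * (1 / 2) ^ k * |Y| := add_le_add h1 (h2.trans (by gcongr))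
    _ = _ := by ring

theorem differentiable_seriesSolution (hY : 0 ≤ Y) (hμ : μ (Ioc 0 Y) < ⊤)
    (hb : IntegrableOn b (Ioc 0 Y)) : Differentiable ℂ fun z => seriesSolution μ b p q z Y := by
  rcases hY.eq_or_lt with rfl | hY
  · simp [seriesSolution]
  intro z
  obtain ⟨D, hD, h⟩ := exists_norm_pow_mul_seriesSolution_coeff_le (p := p) (q := q) hμ hb
    (by positivity : 0 ≤ ‖z‖ + 1)
  have h1 := Complex.differentiableOn_tsum_of_summable_norm (U := Metric.ball 0 (‖z‖ + 1))
    (F := fun k z => z ^ k * ((if k = 0 then p else 0) + ∫ t in Ioc 0 Y, seriesCoeff μ b p q k t))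
    (summable_geometric_two.mul_left D) (fun k => by fun_prop) Metric.isOpen_ball
    (fun k w hw => h w (by simpa using (mem_ball_zero_iff.1 hw).le) k Y ⟨hY, le_rfl⟩)
  have h2 := h1.differentiableAt (Metric.isOpen_ball.mem_nhds (by simp : z ∈ Metric.ball 0 (‖z‖ + 1)))
  refine h2.congr_of_eventuallyEq (Eventually.of_forall fun w => ?_)
  exact (hasSum_seriesSolution hμ hb w).tsum_eq.symm

theorem integrableOn_seriesSolution (hμ : μ (Ioc 0 Y) < ⊤) (hb : IntegrableOn b (Ioc 0 Y)) (z : ℂ) :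
    IntegrableOn (seriesSolution μ b p q z) (Ioc 0 Y) μ :=
  integrableOn_const_add_primitive hμ p (integrableOn_seriesSlope hμ hb z)

theorem seriesSlope_eq (hμ : μ (Ioc 0 Y) < ⊤) (hb : IntegrableOn b (Ioc 0 Y))
    (z : ℂ) : seriesSlope μ b p q z Y = q + z ^ 2 * (∫ s in Ioc 0 Y, seriesSolution μ b p q z s ∂μ)
      - 2 * Complex.I * z * ∫ t in Ioc 0 Y, (b t : ℂ) * seriesSlope μ b p q z t := by
  have hbC : IntegrableOn (fun t => (b t : ℂ)) (Ioc 0 Y) := hb.ofReal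
  have hA := (hasSum_mul_seriesSlope (p := p) (q := q) hμ hb z hbC).2
  have hsub : ∀ s ∈ Ioc 0 Y, Ioc 0 s ⊆ Ioc 0 Y := fun s hs => Ioc_subset_Ioc_right hs.2
  have hM : HasSum (fun k => z ^ k * ∫ s in Ioc 0 Y, ((if k = 0 then p else 0) +
      ∫ t in Ioc 0 s, seriesCoeff μ b p q k t) ∂μ)
      (∫ s in Ioc 0 Y, seriesSolution μ b p q z s ∂μ) := by
    obtain ⟨D, -, h⟩ := exists_norm_pow_mul_seriesSolution_coeff_le (p := p) (q := q) hμ hb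
      (norm_nonneg z)
    have h0 := fun k => integrableOn_const_add_primitive hμ (if k = 0 then p else 0)
      (integrableOn_seriesCoeff (b := b) (p := p) (q := q) hμ hb.ofReal k)
    have h1 := (hasSum_setIntegral_of_geometric (e := fun _ => 1) measurableSet_Ioc
      (integrableOn_const hμ.ne) (fun k => by simpa [IntegrableOn] using (h0 k).const_mul (z ^ k))
      (h z le_rfl)).2
    simp only [one_mul, integral_const_mul] at h1
    rwa [setIntegral_congr_fun measurableSet_Ioc fun s hs =>
      (hasSum_seriesSolution ((measure_mono (hsub s hs)).trans_lt hμ)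
        (hb.mono_set (hsub s hs)) z).tsum_eq] at h1
  have hA1 := (hasSum_nat_add_iff' 1).2 hA
  have h := (hasSum_nat_add_iff (f := fun k => z ^ k * seriesCoeff μ b p q k Y) 2).1
    (((hA1.mul_left (-2 * Complex.I * z)).add (hM.mul_left (z ^ 2))).congr_fun fun k => by
      have e : seriesCoeff μ b p q (k + 2) Y = -2 * Complex.I *
          (∫ t in Ioc 0 Y, (b t : ℂ) * seriesCoeff μ b p q (k + 1) t) + ∫ s in Ioc 0 Y,
            ((if k = 0 then p else 0) + ∫ t in Ioc 0 s, seriesCoeff μ b p q k t) ∂μ := rfl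
      rw [e]
      ring)
  have e0 : seriesCoeff μ b p q 0 Y = q := rfl
  have e1 : seriesCoeff μ b p q 1 Y = -2 * Complex.I *
      ∫ t in Ioc 0 Y, (b t : ℂ) * seriesCoeff μ b p q 0 t := rfl
  rw [seriesSlope, h.tsum_eq]
  simp only [Finset.sum_range_succ, Finset.range_zero, Finset.sum_empty, e0, e1]
  ring

end Series

/-- `φ` solves `φ″ = z² φ (a + b² dt) − 2 i z b φ′` on `(0, Y]` with `φ(0) = p` and
`φ′(0⁺) = q`, the right-continuous version of `φ′` being `v`. -/
structure IsIVPSolution (a : Measure ℝ) (b : ℝ → ℝ) (z p q : ℂ) (Y : ℝ) (φ v : ℝ → ℂ) :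
    Prop where
  sol : Primitive a Y p (fun _ => 0) v φ
  slope : Primitive a Y q (fun y => z ^ 2 * φ y)
    (fun y => z ^ 2 * (φ y * (b y : ℂ) ^ 2) - 2 * Complex.I * z * (v y * b y)) v
  intvb : IntegrableOn (fun t => v t * (b t : ℂ)) (Ioc 0 Y)

section Existence

variable {a : Measure ℝ} {b : ℝ → ℝ} {Y : ℝ}

/-- The measure `a(dy) + b(y)² dy`. -/
def stringMeasure (a : Measure ℝ) (b : ℝ → ℝ) : Measure ℝ :=
  a + (volume : Measure ℝ).withDensity fun t => ENNReal.ofReal (b t ^ 2)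

theorem stringMeasure_Ioc_lt_top (ha : a (Ioc 0 Y) < ⊤)
    (hb : IntegrableOn (fun t => b t ^ 2) (Ioc 0 Y)) : stringMeasure a b (Ioc 0 Y) < ⊤ := by
  rw [stringMeasure, Measure.add_apply, withDensity_apply _ measurableSet_Ioc]
  exact ENNReal.add_lt_top.2 ⟨ha, hb.lintegral_lt_top⟩

theorem integrableOn_stringMeasure (hbm : Measurable b) {g : ℝ → ℂ}
    (hg : IntegrableOn g (Ioc 0 Y) (stringMeasure a b)) :
    IntegrableOn g (Ioc 0 Y) a ∧ IntegrableOn (fun t => g t * (b t : ℂ) ^ 2) (Ioc 0 Y) ∧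
      ∫ t in Ioc 0 Y, g t ∂stringMeasure a b =
        (∫ t in Ioc 0 Y, g t ∂a) + ∫ t in Ioc 0 Y, g t * (b t : ℂ) ^ 2 := by
  obtain ⟨h1, h2⟩ := integrableOn_add_measure.1 hg
  have hm : Measurable fun t => ENNReal.ofReal (b t ^ 2) := (hbm.pow_const 2).ennreal_ofReal
  have e : ∀ t, (ENNReal.ofReal (b t ^ 2)).toReal • g t = g t * (b t : ℂ) ^ 2 := fun t => by
    rw [ENNReal.toReal_ofReal (sq_nonneg _), Complex.real_smul]
    push_cast
    ring
  have h3 := h2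
  rw [IntegrableOn, restrict_withDensity measurableSet_Ioc,
    integrable_withDensity_iff_integrable_smul' hm (by simp)] at h3
  simp only [e] at h3
  refine ⟨h1, h3, ?_⟩
  rw [stringMeasure, Measure.restrict_add, integral_add_measure h1 h2,
    setIntegral_withDensity_eq_setIntegral_toReal_smul hm (by simp) _ measurableSet_Ioc]
  simp only [e]

theorem integrableOn_of_sq (hbm : Measurable b) (hb : IntegrableOn (fun t => b t ^ 2) (Ioc 0 Y)) :
    IntegrableOn b (Ioc 0 Y) := by
  refine (hb.add (integrableOn_const (C := (1 : ℝ)) (by simp))).mono' hbm.aestronglyMeasurable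
    (Eventually.of_forall fun t => ?_)
  rw [Pi.add_apply, Real.norm_eq_abs]
  nlinarith [sq_abs (b t), sq_nonneg (|b t| - 1), abs_nonneg (b t)]

/-- Existence for the initial value problem. -/
theorem isIVPSolution_series (hbm : Measurable b) (ha : a (Ioc 0 Y) < ⊤)
    (hb : IntegrableOn (fun t => b t ^ 2) (Ioc 0 Y)) (z p q : ℂ) :
    IsIVPSolution a b z p q Y (seriesSolution (stringMeasure a b) b p q z)
      (seriesSlope (stringMeasure a b) b p q z) := by
  have hμ := stringMeasure_Ioc_lt_top ha hb
  have hb1 := integrableOn_of_sq hbm hb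
  have hbC : IntegrableOn (fun t => (b t : ℂ)) (Ioc 0 Y) := hb1.ofReal
  have hφ := integrableOn_seriesSolution (p := p) (q := q) hμ hb1 z
  obtain ⟨h1, h2, -⟩ := integrableOn_stringMeasure hbm hφ
  have hvb : IntegrableOn (fun t => seriesSlope (stringMeasure a b) b p q z t * (b t : ℂ))
      (Ioc 0 Y) := by
    simpa only [mul_comm] using (hasSum_mul_seriesSlope (p := p) (q := q) hμ hb1 z hbC).1
  refine ⟨⟨integrableOn_zero, integrableOn_seriesSlope hμ hb1 z, fun y _ => ?_⟩,
    ⟨h1.const_mul _, (h2.const_mul _).sub (hvb.const_mul _), fun y hy => ?_⟩, hvb⟩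
  · simp [seriesSolution]
  · have hsub : Ioc 0 y ⊆ Ioc 0 Y := Ioc_subset_Ioc_right hy.2
    obtain ⟨-, h2', h3'⟩ := integrableOn_stringMeasure hbm (hφ.mono_set hsub)
    rw [seriesSlope_eq ((measure_mono hsub).trans_lt hμ) (hb1.mono_set hsub), h3',
      integral_sub (h2'.const_mul _) ((hvb.mono_set hsub).const_mul _), integral_const_mul,
      integral_const_mul, integral_const_mul]
    simp only [mul_comm (b _ : ℂ)]
    ring

end Existence

namespace IsIVPSolution

variable {a : Measure ℝ} {b : ℝ → ℝ} {z p q p' q' : ℂ} {Y : ℝ} {φ v φ' v' : ℝ → ℂ}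

theorem mono (h : IsIVPSolution a b z p q Y φ v) {y : ℝ} (hy : y ≤ Y) :
    IsIVPSolution a b z p q y φ v :=
  ⟨h.sol.mono hy, h.slope.mono hy, h.intvb.mono_set (Ioc_subset_Ioc_right hy)⟩

theorem add_const_mul (h : IsIVPSolution a b z p q Y φ v) (h' : IsIVPSolution a b z p' q' Y φ' v')
    (c : ℂ) : IsIVPSolution a b z (p + c * p') (q + c * q') Y (fun y => φ y + c * φ' y)
      (fun y => v y + c * v' y) := by
  refine ⟨(h.sol.add (h'.sol.const_mul c)).congr (fun _ _ => by simp) (fun _ _ => rfl)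
    (fun _ _ => rfl), (h.slope.add (h'.slope.const_mul c)).congr (fun _ _ => by ring)
    (fun _ _ => by ring) (fun _ _ => rfl), (h.intvb.add (h'.intvb.const_mul c)).congr
      (Eventually.of_forall fun _ => ?_)⟩
  simp only [Pi.add_apply]
  ring

theorem primitive_conj_sol (h : IsIVPSolution a b z p q Y φ v) :
    Primitive a Y (star p) (fun _ => 0) (fun y => star (v y)) (fun y => star (φ y)) :=
  h.sol.conj.congr (fun _ _ => star_zero ℂ) (fun _ _ => rfl) (fun _ _ => rfl)

end IsIVPSolution

/-- The weight `exp(−2 Im z ∫₀ʸ b)`. -/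
def expWeight (b : ℝ → ℝ) (z : ℂ) (y : ℝ) : ℝ := Real.exp (∫ t in Ioc 0 y, -2 * z.im * b t)

theorem primitive_expWeight {a : Measure ℝ} {b : ℝ → ℝ} {Y : ℝ} (hb : IntegrableOn b (Ioc 0 Y))
    (z : ℂ) : Primitive a Y 1 (fun _ => 0) (fun t => ((-2 * z.im * b t * expWeight b z t : ℝ) : ℂ))
      (fun y => (expWeight b z y : ℂ)) := by
  have h : ∀ y, y ≤ Y → IntegrableOn (fun t => -2 * z.im * b t) (Ioc 0 y) := fun y hy =>
    (hb.mono_set (Ioc_subset_Ioc_right hy)).const_mul _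
  refine ⟨integrableOn_zero, ?_, fun y hy => ?_⟩
  · rcases le_or_gt 0 Y with hY | hY
    · exact (exp_setIntegral_Ioc hY (h Y le_rfl)).1.ofReal
    · simp [Ioc_eq_empty_of_le hY.le]
  · have h2 := (exp_setIntegral_Ioc hy.1.le (h y hy.2)).2
    have h3 := integral_ofReal (𝕜 := ℂ) (μ := volume.restrict (Ioc 0 y))
      (f := fun t => -2 * z.im * b t * expWeight b z t)
    rw [integral_zero, add_zero]
    refine Eq.trans ?_ (congrArg (fun w => 1 + w) h3.symm)
    rw [expWeight, h2]
    push_cast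
    rfl

theorem expWeight_pos (b : ℝ → ℝ) (z : ℂ) (y : ℝ) : 0 < expWeight b z y := Real.exp_pos _

namespace IsIVPSolution

variable {a : Measure ℝ} {b : ℝ → ℝ} {z p q p' q' : ℂ} {Y : ℝ} {φ v φ' v' : ℝ → ℂ}

/-- The energy identity. -/
theorem energy (h : IsIVPSolution a b z p q Y φ v) (ha : a (Ioc 0 Y) < ⊤)
    (hb : IntegrableOn b (Ioc 0 Y)) (hz : z ≠ 0) :
    IntegrableOn (fun s => z.re * ‖φ s‖ ^ 2 * expWeight b z s) (Ioc 0 Y) a ∧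
    IntegrableOn (fun t => z.re / ‖z‖ ^ 2 * ‖v t + Complex.I * z * b t * φ t‖ ^ 2 *
      expWeight b z t) (Ioc 0 Y) ∧
    ∀ y ∈ Ioc 0 Y, (v y * star (φ y) / z).re * expWeight b z y = (q * star p / z).re +
      (∫ s in Ioc 0 y, z.re * ‖φ s‖ ^ 2 * expWeight b z s ∂a) +
      ∫ t in Ioc 0 y, z.re / ‖z‖ ^ 2 * ‖v t + Complex.I * z * b t * φ t‖ ^ 2 * expWeight b z t := by
  have P := ((h.slope.mul ha h.primitive_conj_sol).mul ha
    (primitive_expWeight (a := a) hb z)).const_mul z⁻¹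
  have e1 : ∀ s, (z⁻¹ * (z ^ 2 * φ s * star (φ s) * (expWeight b z s : ℂ))).re =
      z.re * ‖φ s‖ ^ 2 * expWeight b z s := fun s => by
    have : z⁻¹ * (z ^ 2 * φ s * star (φ s) * (expWeight b z s : ℂ)) =
        z * ((‖φ s‖ ^ 2 * expWeight b z s : ℝ) : ℂ) := by
      have := Complex.mul_conj' (φ s)
      rw [Complex.star_def, mul_assoc (z ^ 2), this]
      field_simp
      push_cast
      ring
    rw [this, Complex.re_mul_ofReal, mul_assoc]
  have hzn : ‖z‖ ^ 2 = z.re ^ 2 + z.im ^ 2 := by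
    rw [← Complex.normSq_eq_norm_sq, Complex.normSq_apply]
    ring
  have hzn0 : z.re ^ 2 + z.im ^ 2 ≠ 0 := by
    rw [← hzn]
    positivity
  have e2 : ∀ t, (z⁻¹ * (((z ^ 2 * (φ t * (b t : ℂ) ^ 2) - 2 * Complex.I * z * (v t * b t)) *
      star (φ t) + star (v t) * v t) * (expWeight b z t : ℂ) +
      ((-2 * z.im * b t * expWeight b z t : ℝ) : ℂ) * (v t * star (φ t)))).re =
      z.re / ‖z‖ ^ 2 * ‖v t + Complex.I * z * b t * φ t‖ ^ 2 * expWeight b z t := fun t => by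
    have hn : ∀ w : ℂ, ‖w‖ ^ 2 = w.re ^ 2 + w.im ^ 2 := fun w => by
      rw [← Complex.normSq_eq_norm_sq, Complex.normSq_apply]
      ring
    have : ∀ w : ℂ, (z⁻¹ * w).re = (z.re * w.re + z.im * w.im) / (z.re ^ 2 + z.im ^ 2) := by
      intro w
      rw [Complex.mul_re, Complex.inv_re, Complex.inv_im, Complex.normSq_eq_norm_sq, hzn]
      ring
    rw [this, hzn, hn (v t + _), div_mul_eq_mul_div, div_mul_eq_mul_div]
    congr 1
    simp only [Complex.mul_re, Complex.mul_im, Complex.add_re, Complex.add_im, Complex.sub_re,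
      Complex.sub_im, Complex.star_def, Complex.conj_re, Complex.conj_im, Complex.ofReal_re,
      Complex.ofReal_im, Complex.I_re, Complex.I_im, pow_two, Complex.re_ofNat, Complex.im_ofNat]
    ring
  refine ⟨?_, ?_, fun y hy => ?_⟩
  · have := P.intf.re
    exact this.congr (Eventually.of_forall e1)
  · have := P.intk.re
    exact this.congr (Eventually.of_forall e2)
  · have h3 := P.re_eq hy
    simp only [e1, e2, mul_one] at h3
    rw [div_eq_inv_mul, div_eq_inv_mul, ← h3, ← mul_assoc z⁻¹ _ (expWeight b z y : ℂ),
      Complex.re_mul_ofReal]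

end IsIVPSolution

namespace IsIVPSolution

variable {a : Measure ℝ} {b : ℝ → ℝ} {z p q p' q' : ℂ} {Y : ℝ} {φ v φ' v' : ℝ → ℂ}

theorem re_slope_nonpos (h : IsIVPSolution a b z 1 q Y φ v) (ha : a (Ioc 0 Y) < ⊤)
    (hb : IntegrableOn b (Ioc 0 Y)) (hz : 0 < z.re) (hY : 0 < Y) (h0 : φ Y = 0) :
    (q / z).re ≤ 0 := by
  have hz0 : z ≠ 0 := by
    rintro rfl
    simp at hz
  have he := (h.energy ha hb hz0).2.2 Y ⟨hY, le_rfl⟩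
  have h1 : 0 ≤ ∫ s in Ioc 0 Y, z.re * ‖φ s‖ ^ 2 * expWeight b z s ∂a :=
    integral_nonneg fun s => by have := expWeight_pos b z s; positivity
  have h2 : 0 ≤ ∫ t in Ioc 0 Y, z.re / ‖z‖ ^ 2 * ‖v t + Complex.I * z * b t * φ t‖ ^ 2 *
      expWeight b z t := integral_nonneg fun s => by have := expWeight_pos b z s; positivity
  rw [h0] at he
  simp only [star_zero, mul_zero, zero_div, Complex.zero_re, zero_mul, star_one, mul_one] at he
  linarith

/-- Uniqueness for the Dirichlet problem on `(0, Y)`. -/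
theorem eq_zero_of_endpoints (h : IsIVPSolution a b z 0 q Y φ v) (ha : a (Ioc 0 Y) < ⊤)
    (hb : IntegrableOn b (Ioc 0 Y)) (hz : 0 < z.re) (hY : 0 < Y) (h0 : φ Y = 0) :
    q = 0 ∧ ∀ y ∈ Ioc 0 Y, φ y = 0 := by
  have hz0 : z ≠ 0 := by
    rintro rfl
    simp at hz
  obtain ⟨-, hi, he⟩ := h.energy ha hb hz0
  have he := he Y ⟨hY, le_rfl⟩
  have h1 : 0 ≤ ∫ s in Ioc 0 Y, z.re * ‖φ s‖ ^ 2 * expWeight b z s ∂a :=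
    integral_nonneg fun s => by have := expWeight_pos b z s; positivity
  have hpos : ∀ t, 0 ≤ z.re / ‖z‖ ^ 2 * ‖v t + Complex.I * z * b t * φ t‖ ^ 2 *
      expWeight b z t := fun s => by have := expWeight_pos b z s; positivity
  have h2 : 0 ≤ ∫ t in Ioc 0 Y, z.re / ‖z‖ ^ 2 * ‖v t + Complex.I * z * b t * φ t‖ ^ 2 *
      expWeight b z t := integral_nonneg hpos
  rw [h0] at he
  simp only [star_zero, mul_zero, zero_div, Complex.zero_re, zero_mul] at he
  have h3 : ∀ᵐ t ∂volume.restrict (Ioc 0 Y), v t = -(Complex.I * z * b t * φ t) := by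
    filter_upwards [(integral_eq_zero_iff_of_nonneg hpos hi).1 (by linarith)] with t ht
    have hX := (expWeight_pos b z t).ne'
    have hn : ‖z‖ ≠ 0 := norm_ne_zero_iff.2 hz0
    simp only [Pi.zero_apply, mul_eq_zero, div_eq_zero_iff, hX, hz.ne', pow_eq_zero_iff,
      hn, or_false, false_or, norm_eq_zero, ne_eq, OfNat.ofNat_ne_zero, not_false_eq_true] at ht
    exact eq_neg_of_add_eq_zero_left ht
  have P := (h.sol.mul ha h.primitive_conj_sol).mul ha (primitive_expWeight (a := a) hb z)
  have hφ : ∀ y ∈ Ioc 0 Y, φ y = 0 := by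
    intro y hy
    have h4 := P.eq y hy
    have h5 : ∫ t in Ioc 0 y, (v t * star (φ t) + star (v t) * φ t) * (expWeight b z t : ℂ) +
        ((-2 * z.im * b t * expWeight b z t : ℝ) : ℂ) * (φ t * star (φ t)) = 0 := by
      refine integral_eq_zero_of_ae ?_
      filter_upwards [ae_restrict_of_ae_restrict_of_subset (Ioc_subset_Ioc_right hy.2) h3] with t ht
      rw [ht, Complex.star_def]
      simp only [map_neg, map_mul, Complex.conj_I, Complex.conj_ofReal, Pi.zero_apply]
      have e : z - (starRingEnd ℂ) z = 2 * z.im * Complex.I := by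
        rw [Complex.sub_conj]
        push_cast
        ring
      push_cast
      linear_combination (-Complex.I * b t * φ t * (starRingEnd ℂ) (φ t) * expWeight b z t) * e -
        (2 * z.im * b t * φ t * (starRingEnd ℂ) (φ t) * expWeight b z t) * Complex.I_mul_I
    rw [h5] at h4
    simp only [zero_mul, integral_zero, add_zero] at h4
    have hX : (expWeight b z y : ℂ) ≠ 0 := Complex.ofReal_ne_zero.2 (expWeight_pos b z y).ne'
    simpa [hX] using h4
  refine ⟨?_, hφ⟩
  have h6 : ∀ᵐ t ∂volume.restrict (Ioc 0 Y), t ∈ Ioc 0 Y ∧ v t = 0 := by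
    filter_upwards [h3, ae_restrict_mem measurableSet_Ioc] with t ht htY
    exact ⟨htY, by rw [ht, hφ t htY]; simp⟩
  have h7 : ∀ᵐ t ∂volume.restrict (Ioc 0 Y), v t = 0 := h6.mono fun t ht => ht.2
  have : (ae (volume.restrict (Ioc 0 Y))).NeBot := by
    rw [ae_neBot, Ne, Measure.restrict_eq_zero]
    simp [hY]
  obtain ⟨y, hy, hvy⟩ := h6.exists
  have h8 := h.slope.eq y hy
  have hsub : Ioc 0 y ⊆ Ioc 0 Y := Ioc_subset_Ioc_right hy.2
  rw [hvy, setIntegral_eq_zero_of_forall_eq_zero (fun s hs => by rw [hφ s (hsub hs), mul_zero]),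
    integral_eq_zero_of_ae] at h8
  · simpa using h8.symm
  · filter_upwards [ae_restrict_of_ae_restrict_of_subset hsub h7,
      ae_restrict_mem measurableSet_Ioc] with t ht htY
    simp [ht, hφ t (hsub htY)]

/-- For real `z = ξ > 0`, the function `|φ|²` is convex. -/
theorem norm_sq_le {ξ : ℝ} (h : IsIVPSolution a b ξ p q Y φ v) (ha : a (Ioc 0 Y) < ⊤)
    (hb : IntegrableOn b (Ioc 0 Y)) (hξ : 0 < ξ) {s : ℝ} (hs : s ∈ Ioc 0 Y) :
    Y * ‖φ s‖ ^ 2 ≤ (Y - s) * ‖p‖ ^ 2 + s * ‖φ Y‖ ^ 2 := by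
  have hξ0 : (ξ : ℂ) ≠ 0 := Complex.ofReal_ne_zero.2 hξ.ne'
  set g : ℝ → ℝ := fun t => (v t * star (φ t)).re with hg
  have hX : ∀ t, expWeight b ξ t = 1 := fun t => by simp [expWeight]
  obtain ⟨hi1, hi2, he⟩ := h.energy ha hb hξ0
  simp only [hX, mul_one] at hi1 hi2 he
  have hmono : ∀ y₁ ∈ Ioc 0 Y, ∀ y₂ ∈ Ioc 0 Y, y₁ ≤ y₂ → g y₁ ≤ g y₂ := by
    intro y₁ h₁ y₂ h₂ hle
    have e1 := he y₁ h₁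
    have e2 := he y₂ h₂
    rw [Complex.div_ofReal_re] at e1 e2
    have i1 : ∫ s in Ioc 0 y₁, (ξ : ℂ).re * ‖φ s‖ ^ 2 ∂a ≤ ∫ s in Ioc 0 y₂, (ξ : ℂ).re * ‖φ s‖ ^ 2 ∂a :=
      setIntegral_mono_set (hi1.mono_set (Ioc_subset_Ioc_right h₂.2))
        (Eventually.of_forall fun t => by rw [Complex.ofReal_re]; simp only [Pi.zero_apply]; positivity)
        (Ioc_subset_Ioc_right hle).eventuallyLE
    have i2 := setIntegral_mono_set (hi2.mono_set (Ioc_subset_Ioc_right h₂.2))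
        (Eventually.of_forall fun t => by rw [Complex.ofReal_re]; simp only [Pi.zero_apply]; positivity)
        (Ioc_subset_Ioc_right hle).eventuallyLE
    refine (div_le_div_iff_of_pos_right hξ).1 ?_
    simp only [hg]
    rw [e1, e2]
    linarith
  have P := h.sol.mul ha h.primitive_conj_sol
  have hre : ∀ w : ℂ, (w * star w).re = ‖w‖ ^ 2 := fun w => by
    rw [Complex.star_def, Complex.mul_conj']
    exact_mod_cast Complex.ofReal_re _
  have hden : ∀ t, (v t * star (φ t) + star (v t) * φ t).re = 2 * g t := fun t => by
    simp only [hg, Complex.star_def, Complex.add_re, Complex.mul_re, Complex.conj_re,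
      Complex.conj_im]
    ring
  have hgi : IntegrableOn (fun t => 2 * g t) (Ioc 0 Y) := by
    have := P.intk.re
    exact this.congr (Eventually.of_forall hden)
  have hY : Y ∈ Ioc 0 Y := ⟨hs.1.trans_le hs.2, le_rfl⟩
  have hsq : ∀ y ∈ Ioc 0 Y, ‖φ y‖ ^ 2 = ‖p‖ ^ 2 + ∫ t in Ioc 0 y, 2 * g t := by
    intro y hy
    have := P.re_eq hy
    simpa only [hre, hden, zero_mul, Complex.zero_re, integral_zero, add_zero] using this
  have hsub : Ioc 0 s ⊆ Ioc 0 Y := Ioc_subset_Ioc_right hs.2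
  have hsub' : Ioc s Y ⊆ Ioc 0 Y := Ioc_subset_Ioc_left hs.1.le
  have hsplit : ∫ t in Ioc 0 Y, 2 * g t = (∫ t in Ioc 0 s, 2 * g t) + ∫ t in Ioc s Y, 2 * g t := by
    rw [← setIntegral_union (Ioc_disjoint_Ioc_of_le le_rfl) measurableSet_Ioc (hgi.mono_set hsub)
      (hgi.mono_set hsub'), Ioc_union_Ioc_eq_Ioc hs.1.le hs.2]
  have hlow : ∫ t in Ioc 0 s, 2 * g t ≤ s * (2 * g s) := by
    have := setIntegral_mono_on (hgi.mono_set hsub) (integrableOn_const (by simp))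
      measurableSet_Ioc (g := fun _ => 2 * g s) fun t ht => by
        have := hmono t (hsub ht) s hs ht.2
        linarith
    simpa [hs.1.le] using this
  have hup : (Y - s) * (2 * g s) ≤ ∫ t in Ioc s Y, 2 * g t := by
    have := setIntegral_mono_on (integrableOn_const (by simp)) (hgi.mono_set hsub')
      measurableSet_Ioc (f := fun _ => 2 * g s) fun t ht => by
        have := hmono s hs t (hsub' ht) ht.1.le
        linarith
    simpa [hs.2] using this
  rw [hsq s hs, hsq Y hY, hsplit]
  nlinarith [mul_le_mul_of_nonneg_left hup hs.1.le,
    mul_le_mul_of_nonneg_left hlow (sub_nonneg.2 hs.2)]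

end IsIVPSolution

theorem continuousWithinAt_setIntegral_Ioc_right {ν : Measure ℝ} {f : ℝ → ℂ} {y Y : ℝ} (hy : y < Y)
    (hf : IntegrableOn f (Ioc 0 Y) ν) :
    ContinuousWithinAt (fun x => ∫ t in Ioc 0 x, f t ∂ν) (Ici y) y := by
  have hY : ∀ᶠ x in 𝓝[≥] y, x < Y := mem_nhdsWithin_of_mem_nhds (Iio_mem_nhds hy)
  have e : ∀ x < Y, ∫ t in Ioc 0 x, f t ∂ν =
      ∫ t in Ioc 0 Y, (Ioc 0 x).indicator f t ∂ν := fun x hx => by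
    rw [setIntegral_indicator measurableSet_Ioc, inter_eq_right.2 (Ioc_subset_Ioc_right hx.le)]
  have h : Tendsto (fun x => ∫ t in Ioc 0 Y, (Ioc 0 x).indicator f t ∂ν) (𝓝[≥] y)
      (𝓝 (∫ t in Ioc 0 Y, (Ioc 0 y).indicator f t ∂ν)) := by
    refine tendsto_integral_filter_of_dominated_convergence (fun t => ‖f t‖)
      (Eventually.of_forall fun x => hf.aestronglyMeasurable.indicator measurableSet_Ioc)
      (Eventually.of_forall fun x => Eventually.of_forall fun t => norm_indicator_le_norm_self _ _)
      hf.norm (Eventually.of_forall fun t => ?_)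
    refine tendsto_const_nhds.congr' ?_
    rcases le_or_gt t y with hty | hty
    · filter_upwards [self_mem_nhdsWithin] with x hx
      simp [indicator, hty, hty.trans hx]
    · filter_upwards [mem_nhdsWithin_of_mem_nhds (Iio_mem_nhds hty)] with x hx
      have hx' : ¬ t ≤ x := not_le.2 hx
      simp [indicator, hx', not_le.2 hty]
  rw [ContinuousWithinAt, e y hy]
  exact h.congr' (hY.mono fun x hx => (e x hx).symm)

namespace IsIVPSolution

variable {a : Measure ℝ} {b : ℝ → ℝ} {z p q : ℂ} {Y : ℝ} {φ v : ℝ → ℂ}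

theorem eq_add_setIntegral (h : IsIVPSolution a b z p q Y φ v) {y : ℝ} (hy : y ∈ Ioc 0 Y) :
    φ y = p + ∫ t in Ioc 0 y, v t := by
  simpa using h.sol.eq y hy

theorem continuousOn (h : IsIVPSolution a b z p q Y φ v) (h0 : φ 0 = p) :
    ContinuousOn φ (Icc 0 Y) := by
  refine ((continuousOn_setIntegral_Ioc h.sol.intk).const_add p).congr fun y hy => ?_
  rcases hy.1.eq_or_lt with rfl | hy0
  · simp [h0]
  · exact h.eq_add_setIntegral ⟨hy0, hy.2⟩

theorem tendsto_slope (h : IsIVPSolution a b z p q Y φ v) {y : ℝ} (hy0 : 0 ≤ y) (hy : y < Y) :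
    Tendsto v (𝓝[>] y) (𝓝 (q + (∫ s in Ioc 0 y, z ^ 2 * φ s ∂a) +
      ∫ t in Ioc 0 y, (z ^ 2 * (φ t * (b t : ℂ) ^ 2) - 2 * Complex.I * z * (v t * b t)))) := by
  have h1 := ((continuousWithinAt_setIntegral_Ioc_right hy h.slope.intf).const_add q).add
    (continuousWithinAt_setIntegral_Ioc_right hy h.slope.intk)
  refine (h1.mono_left (nhdsWithin_mono y Ioi_subset_Ici_self)).congr' ?_
  filter_upwards [Ioo_mem_nhdsGT hy] with x hx
  exact (h.slope.eq x ⟨hy0.trans_lt hx.1, hx.2.le⟩).symm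

theorem tendsto_slope_zero (h : IsIVPSolution a b z p q Y φ v) (hY : 0 < Y) :
    Tendsto v (𝓝[>] 0) (𝓝 q) := by
  simpa using h.tendsto_slope le_rfl hY

theorem continuousWithinAt_slope (h : IsIVPSolution a b z p q Y φ v) {y : ℝ} (hy0 : 0 < y)
    (hy : y < Y) : ContinuousWithinAt v (Ici y) y := by
  refine continuousWithinAt_Ioi_iff_Ici.1 ?_
  have := h.tendsto_slope hy0.le hy
  rwa [← h.slope.eq y ⟨hy0, hy.le⟩] at this

end IsIVPSolution

section Interval

variable {R : ℝ≥0∞} {a : Measure ℝ} {b : ℝ → ℝ}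

theorem IsetOf.of_le {y s : ℝ} (hy : y ∈ IsetOf R) (hs : 0 ≤ s) (hsy : s ≤ y) : s ∈ IsetOf R :=
  ⟨hs, (ENNReal.ofReal_le_ofReal hsy).trans_lt hy.2⟩

theorem IsetOf.exists_gt {y : ℝ} (hy : y ∈ IsetOf R) : ∃ Y ∈ IsetOf R, y < Y := by
  obtain ⟨c, hc, hcR⟩ := exists_between hy.2
  have hct : c ≠ ⊤ := hcR.ne_top
  refine ⟨c.toReal, ⟨ENNReal.toReal_nonneg, by rwa [ENNReal.ofReal_toReal hct]⟩, ?_⟩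
  exact (ENNReal.ofReal_lt_iff_lt_toReal hy.1 hct).1 hc

theorem IsetOf.le_toReal (hR : R ≠ ⊤) {y : ℝ} (hy : y ∈ IsetOf R) : y ≤ R.toReal :=
  (ENNReal.ofReal_le_iff_le_toReal hR).1 hy.2.le

theorem eventually_mem_IsetOf (hR0 : 0 < R) (hR : R ≠ ⊤) :
    ∀ᶠ y in 𝓝[<] R.toReal, y ∈ IsetOf R := by
  filter_upwards [Ioo_mem_nhdsLT (ENNReal.toReal_pos hR0.ne' hR)] with y hy
  exact ⟨hy.1.le, (ENNReal.ofReal_lt_iff_lt_toReal hy.1.le hR).2 hy.2⟩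

theorem exists_exhausting_seq (hR : 0 < R) : ∃ r : ℕ → ℝ, Monotone r ∧ (∀ n, 0 < r n) ∧
    (∀ n, r n ∈ IsetOf R) ∧ ∀ y ∈ IsetOf R, ∀ᶠ n in atTop, y ≤ r n := by
  obtain ⟨u, hu, huR, hlim⟩ := exists_seq_strictMono_tendsto' hR
  have hut : ∀ n, u n ≠ ⊤ := fun n => (huR n).2.ne_top
  refine ⟨fun n => (u n).toReal, fun m n hmn => ENNReal.toReal_mono (hut n) (hu.monotone hmn),
    fun n => ENNReal.toReal_pos (huR n).1.ne' (hut n), fun n => ⟨ENNReal.toReal_nonneg, ?_⟩,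
    fun y hy => ?_⟩
  · rw [ENNReal.ofReal_toReal (hut n)]
    exact (huR n).2
  · filter_upwards [hlim.eventually (lt_mem_nhds hy.2)] with n hn
    exact (ENNReal.ofReal_le_iff_le_toReal (hut n)).1 hn.le

theorem LocallyFiniteOnHalf.measure_Ioc_lt_top (ha : LocallyFiniteOnHalf R a) {y : ℝ}
    (hy : y ∈ IsetOf R) : a (Ioc 0 y) < ⊤ :=
  (measure_mono Ioc_subset_Icc_self).trans_lt (ha.2 y hy)

theorem LocL2OnHalf.integrableOn_sq (hb : LocL2OnHalf R b) {y : ℝ} (hy : y ∈ IsetOf R) :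
    IntegrableOn (fun t => b t ^ 2) (Ioc 0 y) :=
  (hb y hy).mono_set Ioc_subset_Icc_self

theorem LocL2OnHalf.integrableOn (hb : LocL2OnHalf R b) (hbm : Measurable b) {y : ℝ}
    (hy : y ∈ IsetOf R) : IntegrableOn b (Ioc 0 y) :=
  integrableOn_of_sq hbm (hb.integrableOn_sq hy)

theorem isStarSolution_of_isIVPSolution {ξ : ℝ} {q : ℂ} {φ v : ℝ → ℂ}
    (ha : LocallyFiniteOnHalf R a) (hb : LocL2OnHalf R b) (h0 : φ 0 = 1)
    (h : ∀ Y ∈ IsetOf R, IsIVPSolution a b ξ 1 q Y φ v)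
    (hbd : ∃ M : ℝ, ∀ y ∈ IsetOf R, ‖φ y‖ ≤ M)
    (hlim : R ≠ ⊤ → Tendsto φ (𝓝[<] R.toReal) (𝓝 0)) : IsStarSolution R a b ξ φ v where
  init := h0
  deriv_integrable y hy := (integrableOn_Icc_iff_integrableOn_Ioc).2 (h y hy).sol.intk
  locAC y hy := by
    rw [intervalIntegral.integral_of_le hy.1]
    rcases hy.1.eq_or_lt with rfl | hy0
    · simp [h0]
    · exact (h y hy).eq_add_setIntegral ⟨hy0, le_rfl⟩
  right_cont y hy hy0 := by
    obtain ⟨Y, hY, hyY⟩ := IsetOf.exists_gt hy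
    exact (h Y hY).continuousWithinAt_slope hy0 hyY
  bounded := hbd
  boundary := hlim
  integ_a y hy := by
    obtain ⟨M, hM⟩ := hbd
    exact (integrableOn_const (C := M) (ha.2 y hy).ne).mono'
      (((h y hy).continuousOn h0).aestronglyMeasurable measurableSet_Icc)
      ((ae_restrict_iff' measurableSet_Icc).2 (Eventually.of_forall fun s hs =>
        hM s (IsetOf.of_le hy hs.1 hs.2)))
  integ_vb y hy := (integrableOn_Icc_iff_integrableOn_Ioc).2 (h y hy).intvb
  integ_φb y hy := by
    have hb2 : IntegrableOn (fun t => (b t : ℂ) ^ 2) (Icc 0 y) := by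
      have := (hb y hy).ofReal (𝕜 := ℂ)
      simpa [IntegrableOn] using this
    exact hb2.continuousOn_mul ((h y hy).continuousOn h0) isCompact_Icc
  eqn y₁ y₂ h₁ h₁₂ h₂ := by
    have H := (h y₂ h₂).slope
    have hsub : Ioc 0 y₁ ⊆ Ioc 0 y₂ := Ioc_subset_Ioc_right h₁₂
    have hsub' : Ioc y₁ y₂ ⊆ Ioc 0 y₂ := Ioc_subset_Ioc_left h₁.le
    rw [H.eq y₂ ⟨h₁.trans_le h₁₂, le_rfl⟩, H.eq y₁ ⟨h₁, h₁₂⟩, ← Ioc_union_Ioc_eq_Ioc h₁.le h₁₂,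
      setIntegral_union (Ioc_disjoint_Ioc_of_le le_rfl) measurableSet_Ioc (H.intf.mono_set hsub)
        (H.intf.mono_set hsub'),
      setIntegral_union (Ioc_disjoint_Ioc_of_le le_rfl) measurableSet_Ioc (H.intk.mono_set hsub)
        (H.intk.mono_set hsub'), intervalIntegral.integral_of_le h₁₂,
      integral_const_mul (μ := a.restrict (Ioc y₁ y₂))]
    simp only [← mul_assoc]
    ring

theorem IsStarSolution.exists_isIVPSolution (hR : 0 < R) {ξ : ℝ} {φ v : ℝ → ℂ}
    (h : IsStarSolution R a b ξ φ v) : ∃ q, ∀ Y ∈ IsetOf R, IsIVPSolution a b ξ 1 q Y φ v := by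
  obtain ⟨Z, hZ, hZ0⟩ := IsetOf.exists_gt (R := R) (y := 0) ⟨le_rfl, by simpa using hR⟩
  set k : ℝ → ℂ := fun y => (ξ : ℂ) ^ 2 * (φ y * (b y : ℂ) ^ 2) -
    2 * Complex.I * ξ * (v y * b y) with hk
  have hf : ∀ y ∈ IsetOf R, IntegrableOn (fun y => (ξ : ℂ) ^ 2 * φ y) (Ioc 0 y) a := fun y hy =>
    ((h.integ_a y hy).mono_set Ioc_subset_Icc_self).const_mul _
  have hki : ∀ y ∈ IsetOf R, IntegrableOn k (Ioc 0 y) := fun y hy =>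
    IntegrableOn.mono_set (((h.integ_φb y hy).const_mul _).sub ((h.integ_vb y hy).const_mul _))
      Ioc_subset_Icc_self
  have hstep : ∀ y₁ y₂ : ℝ, 0 < y₁ → y₁ ≤ y₂ → y₂ ∈ IsetOf R → v y₂ - v y₁ =
      ((∫ s in Ioc 0 y₂, (ξ : ℂ) ^ 2 * φ s ∂a) + ∫ t in Ioc 0 y₂, k t) -
      ((∫ s in Ioc 0 y₁, (ξ : ℂ) ^ 2 * φ s ∂a) + ∫ t in Ioc 0 y₁, k t) := by
    intro y₁ y₂ h₁ h₁₂ h₂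
    have hsub : Ioc 0 y₁ ⊆ Ioc 0 y₂ := Ioc_subset_Ioc_right h₁₂
    have hsub' : Ioc y₁ y₂ ⊆ Ioc 0 y₂ := Ioc_subset_Ioc_left h₁.le
    rw [h.eqn y₁ y₂ h₁ h₁₂ h₂, ← Ioc_union_Ioc_eq_Ioc h₁.le h₁₂,
      setIntegral_union (Ioc_disjoint_Ioc_of_le le_rfl) measurableSet_Ioc
        ((hf y₂ h₂).mono_set hsub) ((hf y₂ h₂).mono_set hsub'),
      setIntegral_union (Ioc_disjoint_Ioc_of_le le_rfl) measurableSet_Ioc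
        ((hki y₂ h₂).mono_set hsub) ((hki y₂ h₂).mono_set hsub'),
      intervalIntegral.integral_of_le h₁₂, integral_const_mul (μ := a.restrict (Ioc y₁ y₂))]
    simp only [hk, ← mul_assoc]
    ring
  refine ⟨v Z - ((∫ s in Ioc 0 Z, (ξ : ℂ) ^ 2 * φ s ∂a) + ∫ t in Ioc 0 Z, k t), fun Y hY =>
    ⟨⟨integrableOn_zero, (h.deriv_integrable Y hY).mono_set Ioc_subset_Icc_self, fun y hy => ?_⟩,
      ⟨hf Y hY, hki Y hY, fun y hy => ?_⟩, (h.integ_vb Y hY).mono_set Ioc_subset_Icc_self⟩⟩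
  · rw [h.locAC y (IsetOf.of_le hY hy.1.le hy.2), intervalIntegral.integral_of_le hy.1.le]
    simp
  · rcases le_total y Z with hyZ | hyZ
    · linear_combination -hstep y Z hy.1 hyZ hZ
    · linear_combination hstep Z y hZ0 hyZ (IsetOf.of_le hY hy.1.le hy.2)

/-- A solution vanishing at `0` which is bounded and, if `R < ∞`, vanishes at `R`, is zero. -/
theorem eq_zero_of_isIVPSolution (hR : 0 < R) (ha : LocallyFiniteOnHalf R a) (hbm : Measurable b)
    (hb : LocL2OnHalf R b) {ξ : ℝ} (hξ : 0 < ξ) {q : ℂ} {φ v : ℝ → ℂ}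
    (h : ∀ Y ∈ IsetOf R, IsIVPSolution a b ξ 0 q Y φ v) {M : ℝ} (hM : ∀ y ∈ IsetOf R, ‖φ y‖ ≤ M)
    (hlim : R ≠ ⊤ → Tendsto φ (𝓝[<] R.toReal) (𝓝 0)) :
    q = 0 ∧ ∀ y ∈ IsetOf R, 0 < y → φ y = 0 := by
  have key : ∀ s ∈ IsetOf R, 0 < s → φ s = 0 := by
    intro s hs hs0
    have hle : ∀ Y ∈ IsetOf R, s ≤ Y → Y * ‖φ s‖ ^ 2 ≤ s * ‖φ Y‖ ^ 2 := fun Y hY hsY => by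
      have := (h Y hY).norm_sq_le (ha.measure_Ioc_lt_top hY) (hb.integrableOn hbm hY) hξ ⟨hs0, hsY⟩
      simpa using this
    by_contra hne
    have hpos : 0 < ‖φ s‖ ^ 2 := by positivity
    rcases eq_or_ne R ⊤ with rfl | hRt
    · set Y := s + s * M ^ 2 / ‖φ s‖ ^ 2 with hYdef
      have hYs : s ≤ Y := le_add_of_nonneg_right (by positivity)
      have hY : Y ∈ IsetOf ⊤ := ⟨hs0.le.trans hYs, ENNReal.ofReal_lt_top⟩
      have h1 := hle Y hY hYs
      have h2 : s * ‖φ Y‖ ^ 2 ≤ s * M ^ 2 := by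
        gcongr
        exact hM Y hY
      have h3 : Y * ‖φ s‖ ^ 2 = s * ‖φ s‖ ^ 2 + s * M ^ 2 := by
        rw [hYdef]
        field_simp
      nlinarith [mul_pos hs0 hpos]
    · have hRpos := ENNReal.toReal_pos hR.ne' hRt
      have hsR : s < R.toReal := (ENNReal.ofReal_lt_iff_lt_toReal hs.1 hRt).1 hs.2
      have h1 : Tendsto (fun Y => s * ‖φ Y‖ ^ 2) (𝓝[<] R.toReal) (𝓝 (s * ‖(0 : ℂ)‖ ^ 2)) :=
        ((hlim hRt).norm.pow 2).const_mul s
      have h2 : s * ‖φ s‖ ^ 2 ≤ s * ‖(0 : ℂ)‖ ^ 2 := by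
        refine ge_of_tendsto h1 ?_
        filter_upwards [eventually_mem_IsetOf hR hRt, Ioo_mem_nhdsLT hsR] with Y hY hsY
        refine le_trans ?_ (hle Y hY hsY.1.le)
        gcongr
        exact hsY.1.le
      simp only [norm_zero] at h2
      nlinarith [mul_pos hs0 hpos]
  obtain ⟨Z, hZ, hZ0⟩ := IsetOf.exists_gt (R := R) (y := 0) ⟨le_rfl, by simpa using hR⟩
  exact ⟨((h Z hZ).eq_zero_of_endpoints (ha.measure_Ioc_lt_top hZ) (hb.integrableOn hbm hZ)
    (by simpa using hξ) hZ0 (key Z hZ hZ0)).1, key⟩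

end Interval

/-- The value of `−φ′(0⁺)` for the solution with `φ(0) = 1` and `φ(r) = 0`. -/
def dirichletSlope (a : Measure ℝ) (b : ℝ → ℝ) (r : ℝ) (z : ℂ) : ℂ :=
  seriesSolution (stringMeasure a b) b 1 0 z r / seriesSolution (stringMeasure a b) b 0 1 z r

/-- The solution with `φ(0) = 1` and `φ′(0⁺) = −h`. -/
def shootingSolution (a : Measure ℝ) (b : ℝ → ℝ) (z h : ℂ) (y : ℝ) : ℂ :=
  seriesSolution (stringMeasure a b) b 1 0 z y - h * seriesSolution (stringMeasure a b) b 0 1 z y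

section Shooting

variable {R : ℝ≥0∞} {a : Measure ℝ} {b : ℝ → ℝ}

theorem isIVPSolution_shooting (ha : LocallyFiniteOnHalf R a) (hbm : Measurable b)
    (hb : LocL2OnHalf R b) {Y : ℝ} (hY : Y ∈ IsetOf R) (z h : ℂ) :
    IsIVPSolution a b z 1 (-h) Y (shootingSolution a b z h) (fun y =>
      seriesSlope (stringMeasure a b) b 1 0 z y - h * seriesSlope (stringMeasure a b) b 0 1 z y) := by
  have := (isIVPSolution_series hbm (ha.measure_Ioc_lt_top hY) (hb.integrableOn_sq hY) z 1
    0).add_const_mul (isIVPSolution_series hbm (ha.measure_Ioc_lt_top hY) (hb.integrableOn_sq hY)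
      z 0 1) (-h)
  have e : shootingSolution a b z h = fun y => seriesSolution (stringMeasure a b) b 1 0 z y -
      h * seriesSolution (stringMeasure a b) b 0 1 z y := rfl
  rw [e]
  simpa [sub_eq_add_neg] using this

theorem seriesSolution_ne_zero (ha : LocallyFiniteOnHalf R a) (hbm : Measurable b)
    (hb : LocL2OnHalf R b) {r : ℝ} (hr : r ∈ IsetOf R) (hr0 : 0 < r) {z : ℂ} (hz : 0 < z.re) :
    seriesSolution (stringMeasure a b) b 0 1 z r ≠ 0 := fun h0 =>
  one_ne_zero ((isIVPSolution_series hbm (ha.measure_Ioc_lt_top hr) (hb.integrableOn_sq hr) z 0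
    1).eq_zero_of_endpoints (ha.measure_Ioc_lt_top hr) (hb.integrableOn hbm hr) hz hr0 h0).1

theorem shootingSolution_dirichletSlope (ha : LocallyFiniteOnHalf R a) (hbm : Measurable b)
    (hb : LocL2OnHalf R b) {r : ℝ} (hr : r ∈ IsetOf R) (hr0 : 0 < r) {z : ℂ} (hz : 0 < z.re) :
    shootingSolution a b z (dirichletSlope a b r z) r = 0 := by
  rw [shootingSolution, dirichletSlope, div_mul_cancel₀ _
    (seriesSolution_ne_zero ha hbm hb hr hr0 hz), sub_self]

theorem differentiableOn_dirichletSlope_div (ha : LocallyFiniteOnHalf R a) (hbm : Measurable b)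
    (hb : LocL2OnHalf R b) {r : ℝ} (hr : r ∈ IsetOf R) (hr0 : 0 < r) :
    DifferentiableOn ℂ (fun z => dirichletSlope a b r z / z) {z | 0 < z.re} := by
  have hμ := stringMeasure_Ioc_lt_top (ha.measure_Ioc_lt_top hr) (hb.integrableOn_sq hr)
  have hd := fun p q => (differentiable_seriesSolution (p := p) (q := q) hr0.le hμ
    (hb.integrableOn hbm hr)).differentiableOn (s := {z | 0 < z.re})
  refine ((hd 1 0).fun_div (hd 0 1) fun z hz => seriesSolution_ne_zero ha hbm hb hr hr0 hz).fun_div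
    differentiableOn_id fun z hz => ?_
  rintro rfl
  simp at hz

theorem re_dirichletSlope_div_nonneg (ha : LocallyFiniteOnHalf R a) (hbm : Measurable b)
    (hb : LocL2OnHalf R b) {r : ℝ} (hr : r ∈ IsetOf R) (hr0 : 0 < r) {z : ℂ} (hz : 0 < z.re) :
    0 ≤ (dirichletSlope a b r z / z).re := by
  have := (isIVPSolution_shooting ha hbm hb hr z (dirichletSlope a b r z)).re_slope_nonpos
    (ha.measure_Ioc_lt_top hr) (hb.integrableOn hbm hr) hz hr0
    (shootingSolution_dirichletSlope ha hbm hb hr hr0 hz)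
  rw [neg_div, Complex.neg_re] at this
  linarith

theorem norm_sq_shootingSolution_le (ha : LocallyFiniteOnHalf R a) (hbm : Measurable b)
    (hb : LocL2OnHalf R b) {r : ℝ} (hr : r ∈ IsetOf R) {ξ : ℝ} (hξ : 0 < ξ) {y : ℝ}
    (hy : y ∈ Ioc 0 r) :
    ‖shootingSolution a b ξ (dirichletSlope a b r ξ) y‖ ^ 2 ≤ 1 - y / r := by
  have hr0 := hy.1.trans_le hy.2
  have := (isIVPSolution_shooting ha hbm hb hr ξ (dirichletSlope a b r ξ)).norm_sq_le
    (ha.measure_Ioc_lt_top hr) (hb.integrableOn hbm hr) hξ hy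
  rw [shootingSolution_dirichletSlope ha hbm hb hr hr0 (by simpa using hξ)] at this
  simp only [norm_one, norm_zero] at this
  rw [one_sub_div hr0.ne', le_div_iff₀ hr0]
  linarith

theorem norm_sq_dirichletSlope_sub_le (ha : LocallyFiniteOnHalf R a) (hbm : Measurable b)
    (hb : LocL2OnHalf R b) {r s : ℝ} (hs : s ∈ IsetOf R) (hrs : r ≤ s) {ξ : ℝ} (hξ : 0 < ξ)
    {y : ℝ} (hy : y ∈ Ioc 0 r) :
    ‖dirichletSlope a b r ξ - dirichletSlope a b s ξ‖ ^ 2 *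
      ‖seriesSolution (stringMeasure a b) b 0 1 ξ y‖ ^ 2 ≤ y * (r⁻¹ - s⁻¹) := by
  have hr0 := hy.1.trans_le hy.2
  have hs0 := hr0.trans_le hrs
  have hξ' : 0 < (ξ : ℂ).re := by simpa using hξ
  have hr := IsetOf.of_le hs hr0.le hrs
  set d := dirichletSlope a b r ξ - dirichletSlope a b s ξ with hd
  set e := seriesSolution (stringMeasure a b) b 0 1 ξ with he
  have hsol := (isIVPSolution_series hbm (ha.measure_Ioc_lt_top hr) (hb.integrableOn_sq hr) ξ 0
    1).norm_sq_le (ha.measure_Ioc_lt_top hr) (hb.integrableOn hbm hr) hξ hy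
  have h1 : shootingSolution a b ξ (dirichletSlope a b s ξ) r = d * e r := by
    have := shootingSolution_dirichletSlope ha hbm hb hr hr0 hξ'
    rw [shootingSolution] at this ⊢
    rw [hd, he]
    linear_combination this
  have h2 := norm_sq_shootingSolution_le ha hbm hb hs hξ ⟨hr0, hrs⟩
  rw [h1, norm_mul, mul_pow] at h2
  rw [norm_zero, zero_pow two_ne_zero, mul_zero, zero_add] at hsol
  have h3 : ‖e y‖ ^ 2 ≤ y / r * ‖e r‖ ^ 2 := by
    rw [div_mul_eq_mul_div, le_div_iff₀ hr0]
    linarith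
  calc ‖d‖ ^ 2 * ‖e y‖ ^ 2 ≤ ‖d‖ ^ 2 * (y / r * ‖e r‖ ^ 2) := by gcongr
    _ = y / r * (‖d‖ ^ 2 * ‖e r‖ ^ 2) := by ring
    _ ≤ y / r * (1 - r / s) := by
      have := hy.1
      gcongr
    _ = y * (r⁻¹ - s⁻¹) := by field_simp

theorem exists_tendsto_dirichletSlope (ha : LocallyFiniteOnHalf R a) (hbm : Measurable b)
    (hb : LocL2OnHalf R b) {r : ℕ → ℝ} (hr : Monotone r) (hr0 : ∀ n, 0 < r n)
    (hrR : ∀ n, r n ∈ IsetOf R) {ξ : ℝ} (hξ : 0 < ξ) :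
    ∃ h, Tendsto (fun n => dirichletSlope a b (r n) ξ) atTop (𝓝 h) := by
  set e := ‖seriesSolution (stringMeasure a b) b 0 1 ξ (r 0)‖ ^ 2 with he
  have he0 : 0 < e := by
    have := seriesSolution_ne_zero ha hbm hb (hrR 0) (hr0 0) (z := ξ) (by simpa using hξ)
    positivity
  have hanti : Antitone fun n => (r n)⁻¹ := fun m n hmn => inv_anti₀ (hr0 m) (hr hmn)
  have hbdd : BddBelow (range fun n => (r n)⁻¹) :=
    ⟨0, by rintro _ ⟨n, rfl⟩; exact (inv_pos.2 (hr0 n)).le⟩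
  set l := ⨅ n, (r n)⁻¹ with hl
  have hlim : Tendsto (fun n => (r n)⁻¹) atTop (𝓝 l) := tendsto_atTop_ciInf hanti hbdd
  refine cauchySeq_tendsto_of_complete (cauchySeq_of_le_tendsto_0
    (fun N => √(r 0 * ((r N)⁻¹ - l) / e) + √(r 0 * ((r N)⁻¹ - l) / e)) ?_ ?_)
  · have key : ∀ N n, N ≤ n → dist (dirichletSlope a b (r N) ξ) (dirichletSlope a b (r n) ξ) ≤
        √(r 0 * ((r N)⁻¹ - l) / e) := by
      intro N n hNn
      have h1 := norm_sq_dirichletSlope_sub_le ha hbm hb (hrR n) (hr hNn) hξ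
        ⟨hr0 0, hr (Nat.zero_le N)⟩
      rw [dist_eq_norm]
      refine Real.le_sqrt_of_sq_le ((le_div_iff₀ he0).2 (h1.trans ?_))
      have h2 : l ≤ (r n)⁻¹ := ciInf_le hbdd n
      have := hr0 0
      gcongr
    intro n m N hn hm
    refine (dist_triangle_left _ _ (dirichletSlope a b (r N) ξ)).trans
      (add_le_add (key N n hn) (key N m hm))
  · have h1 : Tendsto (fun N => √(r 0 * ((r N)⁻¹ - l) / e)) atTop (𝓝 √(r 0 * (l - l) / e)) :=
      (((hlim.sub_const l).const_mul (r 0)).div_const e).sqrt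
    simpa using h1.add h1

theorem norm_sq_shootingSolution_limit_le (ha : LocallyFiniteOnHalf R a) (hbm : Measurable b)
    (hb : LocL2OnHalf R b) {r : ℕ → ℝ} (hrR : ∀ n, r n ∈ IsetOf R)
    (hr : ∀ y ∈ IsetOf R, ∀ᶠ n in atTop, y ≤ r n) {ξ : ℝ} (hξ : 0 < ξ) {h : ℂ}
    (hlim : Tendsto (fun n => dirichletSlope a b (r n) ξ) atTop (𝓝 h)) {y c : ℝ}
    (hy : y ∈ IsetOf R) (hy0 : 0 < y) (hc : ∀ s ∈ IsetOf R, y ≤ s → 1 - y / s ≤ c) :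
    ‖shootingSolution a b ξ h y‖ ^ 2 ≤ c := by
  refine le_of_tendsto ((hlim.mul_const
    (seriesSolution (stringMeasure a b) b 0 1 ξ y)).const_sub
      (seriesSolution (stringMeasure a b) b 1 0 ξ y) |>.norm.pow 2) ?_
  filter_upwards [hr y hy] with n hn
  exact (norm_sq_shootingSolution_le ha hbm hb (hrR n) hξ ⟨hy0, hn⟩).trans (hc _ (hrR n) hn)

theorem shootingSolution_zero (a : Measure ℝ) (b : ℝ → ℝ) (z h : ℂ) :
    shootingSolution a b z h 0 = 1 := by
  simp [shootingSolution, seriesSolution]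

theorem isStarSolution_shooting (hR : 0 < R) (ha : LocallyFiniteOnHalf R a) (hbm : Measurable b)
    (hb : LocL2OnHalf R b) {r : ℕ → ℝ} (hrR : ∀ n, r n ∈ IsetOf R)
    (hr : ∀ y ∈ IsetOf R, ∀ᶠ n in atTop, y ≤ r n) {ξ : ℝ} (hξ : 0 < ξ) {h : ℂ}
    (hlim : Tendsto (fun n => dirichletSlope a b (r n) ξ) atTop (𝓝 h)) :
    IsStarSolution R a b ξ (shootingSolution a b ξ h) (fun y =>
      seriesSlope (stringMeasure a b) b 1 0 ξ y - h * seriesSlope (stringMeasure a b) b 0 1 ξ y) := by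
  refine isStarSolution_of_isIVPSolution ha hb (shootingSolution_zero a b ξ h)
    (fun Y hY => isIVPSolution_shooting ha hbm hb hY ξ h) ⟨1, fun y hy => ?_⟩ fun hRt => ?_
  · rcases hy.1.eq_or_lt with rfl | hy0
    · simp [shootingSolution_zero]
    · refine (sq_le_one_iff₀ (norm_nonneg _)).1
        (norm_sq_shootingSolution_limit_le ha hbm hb hrR hr hξ hlim hy hy0 fun s hs _ => ?_)
      have := div_nonneg hy.1 hs.1
      linarith
  · have hR0 := ENNReal.toReal_pos hR.ne' hRt
    have hbound : ∀ᶠ y in 𝓝[<] R.toReal, ‖shootingSolution a b ξ h y‖ ^ 2 ≤ 1 - y / R.toReal := by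
      filter_upwards [eventually_mem_IsetOf hR hRt, Ioo_mem_nhdsLT hR0] with y hy hy0
      refine norm_sq_shootingSolution_limit_le ha hbm hb hrR hr hξ hlim hy hy0.1 fun s hs hys => ?_
      have := hy0.1.trans_le hys
      have := hy0.1
      gcongr
      exact IsetOf.le_toReal hRt hs
    have hto : Tendsto (fun y => 1 - y / R.toReal) (𝓝[<] R.toReal) (𝓝 0) := by
      have : ContinuousAt (fun y => 1 - y / R.toReal) R.toReal := by fun_prop
      have h1 := this.tendsto.mono_left (nhdsWithin_le_nhds (s := Iio R.toReal))
      rwa [div_self hR0.ne', sub_self] at h1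
    have h2 := (squeeze_zero' (Eventually.of_forall fun y => sq_nonneg _) hbound hto).sqrt
    simp only [Real.sqrt_sq (norm_nonneg _), Real.sqrt_zero] at h2
    exact tendsto_zero_iff_norm_tendsto_zero.2 h2

theorem IsStarSolution.eq_of_isIVPSolution (hR : 0 < R) (ha : LocallyFiniteOnHalf R a)
    (hbm : Measurable b) (hb : LocL2OnHalf R b) {ξ : ℝ} (hξ : 0 < ξ) {q : ℂ} {φ v φ' v' : ℝ → ℂ}
    (h : IsStarSolution R a b ξ φ v) (hq : ∀ Y ∈ IsetOf R, IsIVPSolution a b ξ 1 q Y φ v)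
    (h' : IsStarSolution R a b ξ φ' v') :
    (∀ y ∈ IsetOf R, φ' y = φ y) ∧ Tendsto v' (𝓝[>] 0) (𝓝 q) := by
  obtain ⟨q', hq'⟩ := h'.exists_isIVPSolution hR
  obtain ⟨M, hM⟩ := h.bounded
  obtain ⟨M', hM'⟩ := h'.bounded
  have hD : ∀ Y ∈ IsetOf R, IsIVPSolution a b ξ 0 (q' - q) Y (fun y => φ' y - φ y)
      (fun y => v' y - v y) := fun Y hY => by
    simpa [← sub_eq_add_neg] using (hq' Y hY).add_const_mul (hq Y hY) (-1)
  obtain ⟨h0, hz⟩ := eq_zero_of_isIVPSolution hR ha hbm hb hξ hD (M := M' + M)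
    (fun y hy => (norm_sub_le _ _).trans (add_le_add (hM' y hy) (hM y hy)))
    (fun hRt => by simpa using (h'.boundary hRt).sub (h.boundary hRt))
  obtain ⟨Z, hZ, hZ0⟩ := IsetOf.exists_gt (R := R) (y := 0) ⟨le_rfl, by simpa using hR⟩
  refine ⟨fun y hy => ?_, ?_⟩
  · rcases hy.1.eq_or_lt with rfl | hy0
    · rw [h.init, h'.init]
    · exact sub_eq_zero.1 (hz y hy hy0)
  · rw [← sub_eq_zero.1 h0]
    exact (hq' Z hZ).tendsto_slope_zero hZ0

end Shooting

/-- For data `(R, a, b)` as above, and for each `ξ > 0`, the unique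
solution `φ_ξ` of the boundary-value problem (★) has a right limit `φ_ξ′(0⁺)`, and the
function `ψ(ξ) = −(1/2) φ_ξ′(0⁺) + (1/2) a({0}) ξ²` on `(0, ∞)` extends to a Rogers
function. -/
theorem statement8 (R : ℝ≥0∞) (hR : 0 < R) (a : Measure ℝ)
    (ha : LocallyFiniteOnHalf R a) (b : ℝ → ℝ) (hbmeas : Measurable b)
    (hb : LocL2OnHalf R b) :
    ∃ ψ : ℝ → ℂ, ExtendsToRogersFunction ψ ∧
      ∀ ξ : ℝ, 0 < ξ →
        ∃ (φ v : ℝ → ℂ) (L : ℂ),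
          IsStarSolution R a b ξ φ v ∧
          Filter.Tendsto v (nhdsWithin 0 (Set.Ioi 0)) (nhds L) ∧
          ψ ξ = -(1 / 2 : ℂ) * L
            + (1 / 2 : ℂ) * (((a ({0} : Set ℝ)).toReal : ℂ)) * (ξ : ℂ) ^ 2 ∧
          ∀ φ' v' : ℝ → ℂ, IsStarSolution R a b ξ φ' v' →
            (∀ y ∈ IsetOf R, φ' y = φ y) ∧
            Filter.Tendsto v' (nhdsWithin 0 (Set.Ioi 0)) (nhds L) := by
  obtain ⟨r, hmono, hr0, hrR, hr⟩ := exists_exhausting_seq hR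
  have hex : ∀ ξ : ℝ, ∃ h, 0 < ξ →
      Tendsto (fun n => dirichletSlope a b (r n) ξ) atTop (𝓝 h) := fun ξ => by
    by_cases hξ : 0 < ξ
    · obtain ⟨h, hh⟩ := exists_tendsto_dirichletSlope ha hbmeas hb hmono hr0 hrR hξ
      exact ⟨h, fun _ => hh⟩
    · exact ⟨0, fun h => absurd h hξ⟩
  choose h hh using hex
  obtain ⟨F, hF, hFre, hFh⟩ := exists_limit_of_re_nonneg
    (G := fun n z => dirichletSlope a b (r n) z / z) (γ := fun ξ => h ξ / ξ)
    (fun n => differentiableOn_dirichletSlope_div ha hbmeas hb (hrR n) (hr0 n))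
    (fun n z hz => re_dirichletSlope_div_nonneg ha hbmeas hb (hrR n) (hr0 n) hz)
    (fun ξ hξ => (hh ξ hξ).div_const _)
  set m : ℝ := (a ({0} : Set ℝ)).toReal with hm
  have hm0 : 0 ≤ m := ENNReal.toReal_nonneg
  refine ⟨fun ξ => -(1 / 2 : ℂ) * -h ξ + (1 / 2 : ℂ) * m * (ξ : ℂ) ^ 2,
    ⟨fun z => 1 / 2 * (z * F z) + 1 / 2 * m * z ^ 2, ⟨?_, fun z hz => ?_⟩, fun ξ hξ => ?_⟩,
    fun ξ hξ => ?_⟩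
  · exact ((differentiableOn_id.fun_mul hF).const_mul _).fun_add
      ((differentiableOn_id.fun_pow 2).const_mul _)
  · have hz0 : z ≠ 0 := by
      rintro rfl
      simp at hz
    have e : (1 / 2 * (z * F z) + 1 / 2 * (m : ℂ) * z ^ 2) / z =
        ((1 / 2 : ℝ) : ℂ) * F z + ((1 / 2 * m : ℝ) : ℂ) * z := by
      push_cast
      field_simp
    rw [e, Complex.add_re, Complex.re_ofReal_mul, Complex.re_ofReal_mul]
    have := hFre z hz
    positivity
  · have hξ0 : (ξ : ℂ) ≠ 0 := Complex.ofReal_ne_zero.2 hξ.ne'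
    simp only [hFh ξ hξ]
    rw [mul_div_cancel₀ _ hξ0]
    ring
  · have hsol := isStarSolution_shooting hR ha hbmeas hb hrR hr hξ (hh ξ hξ)
    have hivp := fun Y (hY : Y ∈ IsetOf R) => isIVPSolution_shooting ha hbmeas hb hY ξ (h ξ)
    exact ⟨_, _, -h ξ, hsol, (hsol.eq_of_isIVPSolution hR ha hbmeas hb hξ hivp hsol).2, rfl,
      fun φ' v' h' => hsol.eq_of_isIVPSolution hR ha hbmeas hb hξ hivp h'⟩
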